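/- arXiv:1411.5822 — 9 statements merged into one kernel-verified Lean document; each statement's English description precedes it below -/
import Mathlib

section
/- Let q be a prime, let k ≥ 2, and let f and g be linear Latin hypercubes of order q over F_q and dimension k such that Rect_f = Rect_g and f(x) = g(x) for every point x ∈ F_q^k having at most one nonzero coordinate. Then f = g. -/
/-- `f : A^k → A` is a Latin hypercube: varying any single argument gives a bijection. -/
def IsLatinHypercube {k : ℕ} {A : Type*} (f : (Fin k → A) → A) : Prop :=
  ∀ (i : Fin k) (x : Fin k → A), Function.Bijective fun a => f (Function.update x i a)

/-- A Latin hypercube over `F_q` is linear if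
`α₀(f(x₁,…,x_k)) = α₁(x₁) + ⋯ + α_k(x_k)` for some permutations `α₀,…,α_k`. -/
def IsLinearLH {k : ℕ} {F : Type*} [AddCommMonoid F] (f : (Fin k → F) → F) : Prop :=
  ∃ (α0 : Equiv.Perm F) (α : Fin k → Equiv.Perm F),
    ∀ x, α0 (f x) = ∑ j, α j (x j)

/-- `(a, b, c, d)` is a rectangle of directions `i` and `j`. -/
def IsRectangle {k : ℕ} {A : Type*} (i j : Fin k) (a b c d : Fin k → A) : Prop :=
  a i = b i ∧ c i = d i ∧ b j = c j ∧ d j = a j ∧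
  ∀ l : Fin k, l ≠ i → l ≠ j → a l = b l ∧ b l = c l ∧ c l = d l

/-- `R` is the rectangle function `Rect_f` of `f`. -/
def IsRectFn {k : ℕ} {A : Type*} (f : (Fin k → A) → A) (R : A → A → A → A) : Prop :=
  ∀ (i j : Fin k), i ≠ j →
    ∀ a b c d : Fin k → A, IsRectangle i j a b c d → f a = R (f b) (f c) (f d)

/-- The point `x` is a corner of the rectangle obtained by setting its coordinates `i` and `j`
to `z` separately and together. -/
theorem isRectangle_update {k : ℕ} {A : Type*} {i j : Fin k} (hij : i ≠ j)
    (x : Fin k → A) (z : A) :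
    IsRectangle i j x (Function.update x j z)
      (Function.update (Function.update x i z) j z) (Function.update x i z) := by
  refine ⟨?_, ?_, ?_, ?_, fun l hi hj => ⟨?_, ?_, ?_⟩⟩ <;> simp [*, hij.symm]

/-- Two functions with a common rectangle function that agree on the coordinate axes are equal. -/
theorem eq_of_isRectFn_of_eq_on_axes {k : ℕ} {A : Type*} [Zero A] {f g : (Fin k → A) → A}
    {R : A → A → A → A} (hf : IsRectFn f R) (hg : IsRectFn g R)
    (haxes : ∀ x : Fin k → A, (∀ j j' : Fin k, x j ≠ 0 → x j' ≠ 0 → j = j') → f x = g x) :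
    f = g := by
  classical
  suffices h : ∀ (s : Finset (Fin k)) (x : Fin k → A), (∀ l, x l ≠ 0 → l ∈ s) → f x = g x from
    funext fun x => h Finset.univ x fun l _ => Finset.mem_univ l
  intro s
  induction s using Finset.strongInduction with
  | H s ih =>
    intro x hx
    by_cases hax : ∀ j j' : Fin k, x j ≠ 0 → x j' ≠ 0 → j = j'
    · exact haxes x hax
    push Not at hax
    obtain ⟨i, j, hi, hj, hij⟩ := hax
    have step : ∀ m ∈ s, ∀ y : Fin k → A, y m = 0 → (∀ l, y l ≠ 0 → x l ≠ 0) → f y = g y :=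
      fun m hm y hym hy => ih (s.erase m) (Finset.erase_ssubset hm) y fun l hl =>
        Finset.mem_erase.2 ⟨fun h => hl (h ▸ hym), hx l (hy l hl)⟩
    have hrect := isRectangle_update hij x 0
    have hb : f (Function.update x j 0) = g (Function.update x j 0) :=
      step j (hx j hj) _ (by simp) fun l => by by_cases l = j <;> simp_all
    have hd : f (Function.update x i 0) = g (Function.update x i 0) :=
      step i (hx i hi) _ (by simp) fun l => by by_cases l = i <;> simp_all
    have hc : f (Function.update (Function.update x i 0) j 0) =
        g (Function.update (Function.update x i 0) j 0) :=
      step j (hx j hj) _ (by simp) fun l => by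
        by_cases l = j <;> by_cases l = i <;> simp_all
    rw [hf i j hij _ _ _ _ hrect, hg i j hij _ _ _ _ hrect, hb, hc, hd]

/-- A linear Latin hypercube `f` of prime order is uniquely determined by `Rect_f`
together with its values at the points with at most one nonzero coordinate. -/
theorem linearLH_determined_by_rect_and_axes (q k : ℕ) [Fact q.Prime] (hk : 2 ≤ k)
    (f g : (Fin k → ZMod q) → ZMod q)
    (hflatin : IsLatinHypercube f) (hflin : IsLinearLH f)
    (hglatin : IsLatinHypercube g) (hglin : IsLinearLH g)
    (Rf Rg : ZMod q → ZMod q → ZMod q → ZMod q)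
    (hRf : IsRectFn f Rf) (hRg : IsRectFn g Rg) (hR : Rf = Rg)
    (haxes : ∀ x : Fin k → ZMod q,
      (∀ j j' : Fin k, x j ≠ 0 → x j' ≠ 0 → j = j') → f x = g x) :
    f = g := by
  subst hR
  exact eq_of_isRectFn_of_eq_on_axes hRf hRg haxes
end

section
/- Let q be a prime, let k ≥ 4, and let f be a Latin hypercube of order q over F_q and dimension k such that for every j ∈ {1,…,k} and every a ∈ F_q, the (k−1)-dimensional Latin hypercube obtained from f by fixing the j-th argument to the value a is linear. Then f is linear. -/
/-- The mixed second difference of `g` at `x` in the coordinates `i` and `l` vanishes for all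
increments. -/
def MixedDiffVanishes {ι A G : Type*} [DecidableEq ι] [Add G] (g : (ι → A) → G)
    (x : ι → A) (i l : ι) : Prop :=
  ∀ u v, g (Function.update (Function.update x i u) l v) + g x =
    g (Function.update x i u) + g (Function.update x l v)

/-- A linear section yields a permutation `α` such that `α ∘ f` has vanishing mixed differences on
that section. -/
theorem IsLinearLH.exists_mixedDiffVanishes {F : Type*} [AddCommGroup F] {k : ℕ}
    {f : (Fin (k + 1) → F) → F} {j : Fin (k + 1)} {a : F}
    (h : IsLinearLH fun x : Fin k → F => f (j.insertNth a x)) :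
    ∃ α : Equiv.Perm F, ∀ x, x j = a → ∀ i l, i ≠ l → i ≠ j → l ≠ j →
      MixedDiffVanishes (fun y => α (f y)) x i l := by
  obtain ⟨α, β, hαβ⟩ := h
  have key : ∀ x : Fin (k + 1) → F, x j = a → α (f x) = ∑ m, β m (x (j.succAbove m)) := by
    intro x hx
    have h1 := hαβ (j.removeNth x)
    rw [← hx] at h1
    simpa [Fin.insertNth_self_removeNth, Fin.removeNth] using h1
  refine ⟨α, fun x hx i l hil hi hl u v => ?_⟩
  have hi' := hi.symm
  have hl' := hl.symm
  dsimp only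
  rw [key _ hx, key _ (by simp [hi', hl', hx]), key _ (by simp [hi', hx]),
    key _ (by simp [hl', hx]), ← Finset.sum_add_distrib, ← Finset.sum_add_distrib]
  refine Finset.sum_congr rfl fun m _ => ?_
  by_cases h1 : j.succAbove m = i
  · have h2 : j.succAbove m ≠ l := fun h => hil (h1.symm.trans h)
    simp [h1, hil]
  · by_cases h2 : j.succAbove m = l
    · simp [h2, hil.symm, add_comm]
    · simp [h1, h2]

/-- If mixed differences of both `α ∘ f` and `β ∘ f` vanish on one common two-dimensional face of a
Latin hypercube, then `α ∘ β⁻¹` is affine. -/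
theorem IsLatinHypercube.add_eq_add_of_mixedDiffVanishes {F : Type*} [AddCommGroup F] {n : ℕ}
    {f : (Fin n → F) → F} (hf : IsLatinHypercube f) {α β : Equiv.Perm F}
    {x : Fin n → F} {i l : Fin n}
    (hα : MixedDiffVanishes (fun y => α (f y)) x i l)
    (hβ : MixedDiffVanishes (fun y => β (f y)) x i l)
    {s t s' t' : F} (h : β s + β t = β s' + β t') : α s + α t = α s' + α t' := by
  have key : ∀ s t, ∃ w, β w + β (f x) = β s + β t ∧ α w + α (f x) = α s + α t := by
    intro s t
    obtain ⟨u, hu⟩ := (hf i x).surjective s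
    obtain ⟨v, hv⟩ := (hf l x).surjective t
    dsimp only at hu hv
    refine ⟨_, (hβ u v).trans ?_, (hα u v).trans ?_⟩ <;> simp only [hu, hv]
  obtain ⟨w, hw, hw'⟩ := key s t
  obtain ⟨w', hw₂, hw₂'⟩ := key s' t'
  have : w = w' := β.injective (add_right_cancel (hw.trans (h.trans hw₂.symm)))
  rw [← hw', ← hw₂', this]

/-- A function all of whose mixed differences vanish is a sum of univariate functions. -/
theorem sub_eq_sum_of_mixedDiffVanishes {ι A G : Type*} [Fintype ι] [DecidableEq ι]
    [AddCommGroup G] {g : (ι → A) → G}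
    (hg : ∀ x i l, i ≠ l → MixedDiffVanishes g x i l) (z x : ι → A) :
    g x - g z = ∑ i, (g (Function.update z i (x i)) - g z) := by
  have single : ∀ (s : Finset ι) (i : ι) (u : A), i ∉ s →
      g (Function.update (s.piecewise x z) i u) - g (s.piecewise x z) =
        g (Function.update z i u) - g z := by
    intro s i u
    induction s using Finset.induction_on with
    | empty => simp
    | insert l s _ ih =>
      intro hi
      rw [Finset.mem_insert, not_or] at hi
      rw [← ih hi.2, Finset.piecewise_insert, sub_eq_sub_iff_add_eq_add,
        Function.update_comm (Ne.symm hi.1)]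
      exact hg (s.piecewise x z) i l hi.1 u (x l)
  have partialSum : ∀ s : Finset ι,
      g (s.piecewise x z) - g z = ∑ i ∈ s, (g (Function.update z i (x i)) - g z) := by
    intro s
    induction s using Finset.induction_on with
    | empty => simp
    | insert l s hl ih =>
      rw [Finset.sum_insert hl, ← ih, ← single s l (x l) hl, Finset.piecewise_insert,
        sub_add_sub_cancel]
  simpa using partialSum Finset.univ

/-- A Latin hypercube whose mixed differences vanish after a permutation of the values is linear. -/
theorem IsLatinHypercube.isLinearLH_of_mixedDiffVanishes {F : Type*} [AddCommGroup F] {n : ℕ}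
    {f : (Fin n → F) → F} (hf : IsLatinHypercube f) (α : Equiv.Perm F)
    (hα : ∀ x i l, i ≠ l → MixedDiffVanishes (fun y => α (f y)) x i l) : IsLinearLH f := by
  let shift : Equiv.Perm F := α.trans (Equiv.subRight (α (f 0)))
  refine ⟨shift, fun i => (Equiv.ofBijective _ (hf i 0)).trans shift, fun x => ?_⟩
  simpa [shift] using sub_eq_sum_of_mixedDiffVanishes hα 0 x

/-- If every `(k-1)`-dimensional Latin hypercube obtained from a Latin hypercube `f` of
prime order and dimension `k ≥ 4` by fixing one argument is linear, then `f` is linear.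
(Here the dimension of `f` is `k + 1 ≥ 4`.) -/
theorem latinHypercube_linear_of_sections_linear (q k : ℕ) [Fact q.Prime]
    (hk : 4 ≤ k + 1)
    (f : (Fin (k + 1) → ZMod q) → ZMod q)
    (hlatin : IsLatinHypercube f)
    (hsec : ∀ (j : Fin (k + 1)) (a : ZMod q),
      IsLinearLH fun x : Fin k → ZMod q => f (j.insertNth a x)) :
    IsLinearLH f := by
  choose α hα using fun j a => (hsec j a).exists_mixedDiffVanishes
  have avoid : ∀ s : Finset (Fin (k + 1)), s.card < 4 → ∃ i, i ∉ s := by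
    intro s hs
    by_contra! h
    have := Finset.card_le_card (fun i _ => h i : Finset.univ ⊆ s)
    rw [Finset.card_fin] at this
    omega
  have transfer : ∀ (γ : Equiv.Perm (ZMod q)) (j j' : Fin (k + 1)) (a b : ZMod q), j ≠ j' →
      (∀ x, x j = a → ∀ i l, i ≠ l → i ≠ j → l ≠ j →
        MixedDiffVanishes (fun y => γ (f y)) x i l) →
      ∀ x, x j' = b → ∀ i l, i ≠ l → i ≠ j' → l ≠ j' →
        MixedDiffVanishes (fun y => γ (f y)) x i l := by
    intro γ j j' a b hj hγ x hx i l hil hi hl u v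
    obtain ⟨m, hm⟩ := avoid {j, j'} (Finset.card_le_two.trans_lt (by norm_num))
    obtain ⟨p, hp⟩ := avoid {m, j, j'} (Finset.card_le_three.trans_lt (by norm_num))
    simp only [Finset.mem_insert, Finset.mem_singleton, not_or] at hm hp
    let c : Fin (k + 1) → ZMod q := Function.update (fun _ => b) j a
    have hc : c j = a := by simp [c]
    have hc' : c j' = b := by simp [c, hj.symm]
    exact hlatin.add_eq_add_of_mixedDiffVanishes
      (hγ c hc m p (Ne.symm hp.1) hm.1 hp.2.1)
      (hα j' b c hc' m p (Ne.symm hp.1) hm.2 hp.2.2)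
      (hα j' b x hx i l hil hi hl u v)
  obtain ⟨r, hr⟩ := avoid {0} (by simp)
  rw [Finset.mem_singleton] at hr
  have away := fun j b (hj : 0 ≠ j) => transfer (α 0 0) 0 j 0 b hj (hα 0 0)
  refine hlatin.isLinearLH_of_mixedDiffVanishes (α 0 0) fun x i l hil => ?_
  obtain ⟨j, hj⟩ := avoid {i, l} (Finset.card_le_two.trans_lt (by norm_num))
  simp only [Finset.mem_insert, Finset.mem_singleton, not_or] at hj
  by_cases h0 : 0 = j
  · subst h0
    exact transfer (α 0 0) r 0 0 (x 0) hr (away r 0 (Ne.symm hr)) x rfl i l hil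
      (Ne.symm hj.1) (Ne.symm hj.2)
  · exact away j (x j) h0 x rfl i l hil (Ne.symm hj.1) (Ne.symm hj.2)
end

section
/- Let q be a prime, let c ∈ F_q, let a_1, a_2, a_3 ∈ F_q \ {0}, and let γ_1, γ_2, γ_3 be permutations of F_q. If γ_1(x_1) + γ_2(x_2) + γ_3(x_3) = c for all x_1, x_2, x_3 ∈ F_q satisfying a_1 x_1 + a_2 x_2 + a_3 x_3 = 0, then γ_1, γ_2, and γ_3 are affine transformations of F_q. -/
/-- `γ` is an affine transformation of `F_q`, i.e. `x ↦ b*x + c` with `b ≠ 0`. -/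
def IsAffineMap {q : ℕ} (γ : ZMod q → ZMod q) : Prop :=
  ∃ b c : ZMod q, b ≠ 0 ∧ ∀ x, γ x = b * x + c

/-- An injective map on `ZMod q` that is additive up to its value at `0` is affine. -/
lemma IsAffineMap.of_map_add {q : ℕ} [Fact q.Prime] {γ : ZMod q → ZMod q}
    (hγ : Function.Injective γ) (hadd : ∀ x y, γ (x + y) + γ 0 = γ x + γ y) :
    IsAffineMap γ := by
  let f : ZMod q →+ ZMod q := AddMonoidHom.mk' (fun x => γ x - γ 0) fun x y => by
    linear_combination hadd x y
  refine ⟨γ 1 - γ 0, γ 0, sub_ne_zero.mpr (hγ.ne one_ne_zero), fun x => ?_⟩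
  have hf : γ x - γ 0 = x * (γ 1 - γ 0) := by
    simpa [f] using ZMod.map_smul f x 1
  linear_combination hf

/-- If `γ₁ x₁ + γ₂ x₂ + γ₃ x₃` is constant on a plane with nonzero coefficients and `γ₁` is
injective, then `γ₁` is affine. -/
lemma IsAffineMap.of_sum_constant_on_plane {q : ℕ} [Fact q.Prime] {c a₁ a₂ a₃ : ZMod q}
    (ha₂ : a₂ ≠ 0) (ha₃ : a₃ ≠ 0) {γ₁ γ₂ γ₃ : ZMod q → ZMod q} (hγ : Function.Injective γ₁)
    (h : ∀ x₁ x₂ x₃ : ZMod q, a₁ * x₁ + a₂ * x₂ + a₃ * x₃ = 0 → γ₁ x₁ + γ₂ x₂ + γ₃ x₃ = c) :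
    IsAffineMap γ₁ := by
  have key : ∀ x y, γ₁ (x + y) + γ₂ 0 = γ₁ x + γ₂ (a₁ * y / a₂) := fun x y => by
    have h₁ := h (x + y) 0 (-(a₁ * (x + y)) / a₃) (by field_simp; ring)
    have h₂ := h x (a₁ * y / a₂) (-(a₁ * (x + y)) / a₃) (by field_simp; ring)
    linear_combination h₁ - h₂
  refine .of_map_add hγ fun x y => ?_
  have hy := key 0 y
  rw [zero_add] at hy
  linear_combination key x y - hy

/-- If permutations `γ₁, γ₂, γ₃` of `F_q` (`q` prime) satisfy
`γ₁(x₁) + γ₂(x₂) + γ₃(x₃) = c` whenever `a₁x₁ + a₂x₂ + a₃x₃ = 0` (with `a₁,a₂,a₃ ≠ 0`),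
then each `γᵢ` is an affine transformation. -/
theorem affine_of_sum_constant_on_plane (q : ℕ) [Fact q.Prime] (c : ZMod q)
    (a₁ a₂ a₃ : ZMod q) (ha₁ : a₁ ≠ 0) (ha₂ : a₂ ≠ 0) (ha₃ : a₃ ≠ 0)
    (γ₁ γ₂ γ₃ : Equiv.Perm (ZMod q))
    (h : ∀ x₁ x₂ x₃ : ZMod q, a₁ * x₁ + a₂ * x₂ + a₃ * x₃ = 0 →
      γ₁ x₁ + γ₂ x₂ + γ₃ x₃ = c) :
    IsAffineMap ⇑γ₁ ∧ IsAffineMap ⇑γ₂ ∧ IsAffineMap ⇑γ₃ := by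
  exact ⟨.of_sum_constant_on_plane ha₂ ha₃ γ₁.injective h,
    .of_sum_constant_on_plane (c := c) (a₁ := a₂) (γ₂ := γ₁) (γ₃ := γ₃) ha₁ ha₃ γ₂.injective
      fun x₂ x₁ x₃ hx => by
        linear_combination h x₁ x₂ x₃ (by linear_combination hx),
    .of_sum_constant_on_plane (c := c) (a₁ := a₃) (γ₂ := γ₁) (γ₃ := γ₂) ha₁ ha₂ γ₃.injective
      fun x₃ x₁ x₂ hx => by
        linear_combination h x₁ x₂ x₃ (by linear_combination hx)⟩
end

section
/- Let q be a prime, let r ≥ 2 and k ≥ 4, and let (f_1,…,f_r) be an r-tuple of Latin hypercubes of order q over F_q and dimension k such that for all 1 ≤ i_1 < i_2 ≤ r, for every choice of k−3 argument positions and values fixed identically in f_{i_1} and f_{i_2}, the resulting pair of 3-dimensional Latin hypercubes (Latin cubes) is a linear 2-tuple. Then (f_1,…,f_r) is a linear r-tuple of Latin hypercubes. -/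
/-- An `r`-tuple of Latin hypercubes over `F_q` is linear if there are permutations
`α₁,…,α_k, β₁,…,β_r` of `F_q` and coefficients `a i j` such that
`βᵢ(fᵢ(x₁,…,x_k)) = aᵢ₁α₁(x₁) + ⋯ + aᵢₖαₖ(xₖ)` for all `i`. -/
def IsLinearTuple {r k q : ℕ} (f : Fin r → (Fin k → ZMod q) → ZMod q) : Prop :=
  ∃ (α : Fin k → Equiv.Perm (ZMod q)) (β : Fin r → Equiv.Perm (ZMod q))
    (a : Fin r → Fin k → ZMod q),
    ∀ (i : Fin r) (x : Fin k → ZMod q),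
      β i (f i x) = ∑ j, a i j * α j (x j)

/-- The 3-dimensional Latin cube obtained from a `k`-dimensional Latin hypercube `f`
by keeping the three argument positions selected by the embedding `e` free and fixing
all other arguments to the values given by `y`. -/
noncomputable def fixToCube {k q : ℕ} (f : (Fin k → ZMod q) → ZMod q)
    (e : Fin 3 ↪ Fin k) (y : Fin k → ZMod q) : (Fin 3 → ZMod q) → ZMod q :=
  fun x => f (Function.extend (⇑e) x y)

open Function

/-- The restriction of `φ` to the plane through `y` in directions `i`, `j` splits as a sum of
functions of one variable; expressed by the vanishing of all mixed differences. -/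
def SplitsOnPlane {k q : ℕ} (φ : (Fin k → ZMod q) → ZMod q) (i j : Fin k)
    (y : Fin k → ZMod q) : Prop :=
  ∀ a a' b b' : ZMod q,
    φ (update (update y i a) j b) + φ (update (update y i a') j b') =
      φ (update (update y i a) j b') + φ (update (update y i a') j b)

/-- Every three-dimensional subcube of `φ` is, up to a permutation of the values, a sum of
functions of one variable. -/
def HasSplitCubes {k q : ℕ} (φ : (Fin k → ZMod q) → ZMod q) : Prop :=
  ∀ (i j l : Fin k), i ≠ j → i ≠ l → j ≠ l → ∀ y : Fin k → ZMod q,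
    ∃ (β : Equiv.Perm (ZMod q)) (A B C : ZMod q → ZMod q), ∀ a b c,
      β (φ (update (update (update y i a) j b) l c)) = A a + B b + C c

theorem ZMod.affine_of_map_add {q : ℕ} (β P Q : ZMod q → ZMod q)
    (h : ∀ u v, β (u + v) = P u + Q v) : ∃ s c, ∀ u, β u = s * u + c := by
  have hadd : ∀ u v, β (u + v) - β 0 = (β u - β 0) + (β v - β 0) := by
    intro u v
    have h1 := h u 0
    have h2 := h 0 v
    have h3 := h 0 0
    simp only [add_zero, zero_add] at h1 h2 h3
    rw [h u v, h1, h2, h3]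
    ring
  let g : ZMod q →+ ZMod q := AddMonoidHom.mk' (fun u => β u - β 0) hadd
  refine ⟨g 1, β 0, fun u => ?_⟩
  have hg : g u = u * g 1 := by
    have := (g.toZModLinearMap q).map_smul u 1
    simpa using this
  have hu : g u = β u - β 0 := rfl
  rw [mul_comm, ← hg, hu]
  ring

theorem IsLatinHypercube.perm_comp {k : ℕ} {A : Type*} {f : (Fin k → A) → A}
    (hf : IsLatinHypercube f) (δ : Equiv.Perm A) : IsLatinHypercube fun x => δ (f x) :=
  fun i x => δ.bijective.comp (hf i x)

theorem HasSplitCubes.perm_comp {k q : ℕ} {f : (Fin k → ZMod q) → ZMod q}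
    (hf : HasSplitCubes f) (δ : Equiv.Perm (ZMod q)) : HasSplitCubes fun x => δ (f x) := by
  intro i j l hij hil hjl y
  obtain ⟨β, A, B, C, h⟩ := hf i j l hij hil hjl y
  exact ⟨δ.symm.trans β, A, B, C, fun a b c => by simpa using h a b c⟩

section Splitting

variable {k q : ℕ} {φ : (Fin k → ZMod q) → ZMod q} {i j l : Fin k} {y : Fin k → ZMod q}

theorem SplitsOnPlane.symm (hij : i ≠ j) (h : SplitsOnPlane φ i j y) :
    SplitsOnPlane φ j i y := by
  intro a a' b b'
  have := h b b' a a'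
  simp only [update_comm hij] at this
  linear_combination this

theorem SplitsOnPlane.update_left (c : ZMod q) (h : SplitsOnPlane φ i j y) :
    SplitsOnPlane φ i j (update y i c) := by
  intro a a' b b'
  simpa only [update_idem] using h a a' b b'

theorem SplitsOnPlane.update_right (hij : i ≠ j) (c : ZMod q) (h : SplitsOnPlane φ i j y) :
    SplitsOnPlane φ i j (update y j c) :=
  ((h.symm hij).update_left c).symm hij.symm

/-- A permutation of the values preserving a splitting on one plane of a Latin hypercube is
affine. -/
theorem SplitsOnPlane.exists_affine [Nontrivial (ZMod q)] (hφ : IsLatinHypercube φ) (hij : i ≠ j)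
    (h : SplitsOnPlane φ i j y) (β : Equiv.Perm (ZMod q)) (A B : ZMod q → ZMod q)
    (hβ : ∀ a b, β (φ (update (update y i a) j b)) = A a + B b) :
    ∃ s c, s ≠ 0 ∧ ∀ u, β u = s * u + c := by
  have hp : Surjective fun a => φ (update (update y i a) j 0) := by
    simpa only [update_comm hij.symm] using (hφ i (update y j 0)).2
  have hs := (hφ j (update y i 0)).2
  obtain ⟨p, hp⟩ := hp.hasRightInverse
  obtain ⟨t, ht⟩ := hs.hasRightInverse
  let c₀ := φ (update (update y i 0) j 0)
  obtain ⟨s, c, hsc⟩ := ZMod.affine_of_map_add β (fun u => A (p (u + c₀))) (fun v => B (t v)) (by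
    intro u v
    rw [← hβ]
    congr 1
    have h1 := h (p (u + c₀)) 0 (t v) 0
    have h2 := hp (u + c₀)
    have h3 := ht v
    simp only [c₀] at h1 h2 h3 ⊢
    linear_combination -h1 - h2 - h3)
  refine ⟨s, c, ?_, hsc⟩
  rintro rfl
  exact zero_ne_one (β.injective (by simp [hsc]))

theorem SplitsOnPlane.exists_cube [Fact q.Prime] (hφ : IsLatinHypercube φ)
    (hc : HasSplitCubes φ) (hij : i ≠ j) (hil : i ≠ l) (hjl : j ≠ l)
    (h : SplitsOnPlane φ i j y) :
    ∃ A B C : ZMod q → ZMod q, ∀ a b c,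
      φ (update (update (update y i a) j b) l c) = A a + B b + C c := by
  obtain ⟨β, A, B, C, hβ⟩ := hc i j l hij hil hjl y
  obtain ⟨s, t, hs, hst⟩ := h.exists_affine hφ hij β A (fun b => B b + C (y l)) (by
    intro a b
    rw [← add_assoc, ← hβ]
    congr 2
    refine (update_eq_self_iff.2 ?_).symm
    simp [update_of_ne hil.symm, update_of_ne hjl.symm])
  refine ⟨fun a => s⁻¹ * (A a - t), fun b => s⁻¹ * B b, fun c => s⁻¹ * C c, fun a b c => ?_⟩
  have := hβ a b c
  rw [hst] at this
  field_simp
  linear_combination this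

theorem SplitsOnPlane.update_of_ne [Fact q.Prime] (hφ : IsLatinHypercube φ)
    (hc : HasSplitCubes φ) (hij : i ≠ j) (hil : i ≠ l) (hjl : j ≠ l)
    (h : SplitsOnPlane φ i j y) (c : ZMod q) : SplitsOnPlane φ i j (update y l c) := by
  obtain ⟨A, B, C, hA⟩ := h.exists_cube hφ hc hij hil hjl
  intro a a' b b'
  simp only [update_comm hil.symm, update_comm hjl.symm, hA]
  ring

theorem SplitsOnPlane.change_right [Fact q.Prime] (hφ : IsLatinHypercube φ)
    (hc : HasSplitCubes φ) (hij : i ≠ j) (hil : i ≠ l)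
    (h : SplitsOnPlane φ i j y) : SplitsOnPlane φ i l y := by
  by_cases hjl : j = l
  · exact hjl ▸ h
  obtain ⟨A, B, C, hA⟩ := h.exists_cube hφ hc hij hil hjl
  have key : ∀ a c, φ (update (update y i a) l c) = A a + B (y j) + C c := by
    intro a c
    rw [← hA]
    congr 2
    exact (update_eq_self_iff.2 (Function.update_of_ne hij.symm _ _).symm).symm
  intro a a' b b'
  simp only [key]
  ring

theorem SplitsOnPlane.translate [Fact q.Prime] (hφ : IsLatinHypercube φ)
    (hc : HasSplitCubes φ) (hij : i ≠ j) (h : SplitsOnPlane φ i j y)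
    (y' : Fin k → ZMod q) : SplitsOnPlane φ i j y' := by
  have key : ∀ s : Finset (Fin k), SplitsOnPlane φ i j (s.piecewise y' y) := by
    intro s
    induction s using Finset.induction_on with
    | empty => simpa using h
    | insert m s _ ih =>
      rw [Finset.piecewise_insert]
      by_cases him : i = m
      · subst him
        exact ih.update_left _
      by_cases hjm : j = m
      · subst hjm
        exact ih.update_right hij _
      exact ih.update_of_ne hφ hc hij him hjm _
  simpa using key Finset.univ

theorem SplitsOnPlane.all_planes [Fact q.Prime] (hφ : IsLatinHypercube φ)
    (hc : HasSplitCubes φ) (hij : i ≠ j) (h : SplitsOnPlane φ i j y)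
    (i' j' : Fin k) (hij' : i' ≠ j') (y' : Fin k → ZMod q) : SplitsOnPlane φ i' j' y' := by
  refine SplitsOnPlane.translate hφ hc hij' (y := y) ?_ y'
  by_cases hi : i = i'
  · subst hi
    exact h.change_right hφ hc hij hij'
  · exact ((h.change_right hφ hc hij hi).symm hi).change_right hφ hc (Ne.symm hi) hij'

theorem sub_eq_of_splitsOnPlane (h : ∀ i j, i ≠ j → ∀ y, SplitsOnPlane φ i j y) (m : Fin k)
    (a b : ZMod q) (y : Fin k → ZMod q) :
    φ (update y m a) - φ (update y m b) = φ (update 0 m a) - φ (update 0 m b) := by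
  have key : ∀ s : Finset (Fin k),
      φ (update (s.piecewise y 0) m a) - φ (update (s.piecewise y 0) m b) =
        φ (update 0 m a) - φ (update 0 m b) := by
    intro s
    induction s using Finset.induction_on with
    | empty => simp
    | insert n s hn ih =>
      rw [Finset.piecewise_insert, ← ih]
      by_cases hnm : n = m
      · subst hnm
        simp only [update_idem]
      set w := s.piecewise y (0 : Fin k → ZMod q)
      have h1 := h n m hnm w (y n) (w n) a b
      rw [update_eq_self] at h1
      linear_combination h1
  simpa using key Finset.univ

theorem eq_sum_of_splitsOnPlane (h : ∀ i j, i ≠ j → ∀ y, SplitsOnPlane φ i j y)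
    (x : Fin k → ZMod q) :
    φ x = φ 0 + ∑ j, (φ (update 0 j (x j)) - φ 0) := by
  have key : ∀ s : Finset (Fin k),
      φ (s.piecewise x 0) = φ 0 + ∑ j ∈ s, (φ (update 0 j (x j)) - φ 0) := by
    intro s
    induction s using Finset.induction_on with
    | empty => simp
    | insert n s hn ih =>
      rw [Finset.piecewise_insert, Finset.sum_insert hn]
      have h1 := sub_eq_of_splitsOnPlane h n (x n) 0 (s.piecewise x 0)
      have h2 : update (s.piecewise x 0) n 0 = s.piecewise x (0 : Fin k → ZMod q) :=
        update_eq_self_iff.2 (by simp [hn])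
      have h3 : update (0 : Fin k → ZMod q) n 0 = 0 := update_eq_self_iff.2 rfl
      rw [h2, h3] at h1
      linear_combination h1 + ih
  simpa using key Finset.univ

end Splitting

theorem exists_perm_forall_splitsOnPlane {k q : ℕ} [Fact q.Prime] (hk : 3 ≤ k)
    {f : (Fin k → ZMod q) → ZMod q} (hf : IsLatinHypercube f) (hc : HasSplitCubes f) :
    ∃ δ : Equiv.Perm (ZMod q), ∀ i j, i ≠ j → ∀ y, SplitsOnPlane (fun x => δ (f x)) i j y := by
  let i₀ : Fin k := ⟨0, by omega⟩
  let j₀ : Fin k := ⟨1, by omega⟩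
  let l₀ : Fin k := ⟨2, by omega⟩
  have hij : i₀ ≠ j₀ := by simp [i₀, j₀]
  have hil : i₀ ≠ l₀ := by simp [i₀, l₀]
  have hjl : j₀ ≠ l₀ := by simp [j₀, l₀]
  obtain ⟨δ, A, B, C, h⟩ := hc i₀ j₀ l₀ hij hil hjl 0
  refine ⟨δ, SplitsOnPlane.all_planes (i := i₀) (j := j₀) (y := update 0 l₀ 0)
    (hf.perm_comp δ) (hc.perm_comp δ) hij ?_⟩
  intro a a' b b'
  simp only [update_comm hil.symm, update_comm hjl.symm, h]
  ring

/-- The conclusion of linearity of a pair, on the cube through `y` in directions `i`, `j`, `l`. -/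
theorem exists_of_isLinearTuple_fixToCube {k q : ℕ} {f g : (Fin k → ZMod q) → ZMod q}
    (h : ∀ (e : Fin 3 ↪ Fin k) (y : Fin k → ZMod q),
      IsLinearTuple ![fixToCube f e y, fixToCube g e y])
    {i j l : Fin k} (hij : i ≠ j) (hil : i ≠ l) (hjl : j ≠ l) (y : Fin k → ZMod q) :
    ∃ (γ : Fin 3 → Equiv.Perm (ZMod q)) (β β' : Equiv.Perm (ZMod q)) (s t : Fin 3 → ZMod q),
      ∀ a b c,
        β (f (update (update (update y i a) j b) l c)) =
          s 0 * γ 0 a + s 1 * γ 1 b + s 2 * γ 2 c ∧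
        β' (g (update (update (update y i a) j b) l c)) =
          t 0 * γ 0 a + t 1 * γ 1 b + t 2 * γ 2 c := by
  let e : Fin 3 ↪ Fin k := ⟨![i, j, l], by
    intro m n
    fin_cases m <;> fin_cases n <;> simp [hij, hil, hjl, hij.symm, hil.symm, hjl.symm]⟩
  obtain ⟨γ, β, s, hβ⟩ := h e y
  have hext : ∀ a b c, extend e ![a, b, c] y = update (update (update y i a) j b) l c := by
    intro a b c
    funext m
    have h0 : extend e ![a, b, c] y i = a := e.injective.extend_apply ![a, b, c] y 0
    have h1 : extend e ![a, b, c] y j = b := e.injective.extend_apply ![a, b, c] y 1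
    have h2 : extend e ![a, b, c] y l = c := e.injective.extend_apply ![a, b, c] y 2
    by_cases hl : m = l
    · subst hl
      simp [h2]
    by_cases hj : m = j
    · subst hj
      simp [h1, hl]
    by_cases hi : m = i
    · subst hi
      simp [h0, hl, hj]
    rw [extend_apply' _ _ _ (by
      rintro ⟨n, rfl⟩
      fin_cases n
      exacts [hi rfl, hj rfl, hl rfl])]
    simp [hl, hj, hi]
  refine ⟨γ, β 0, β 1, s 0, s 1, fun a b c => ⟨?_, ?_⟩⟩
  · simpa [fixToCube, hext, Fin.sum_univ_three] using hβ 0 ![a, b, c]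
  · simpa [fixToCube, hext, Fin.sum_univ_three] using hβ 1 ![a, b, c]

theorem hasSplitCubes_of_isLinearTuple_fixToCube {k q : ℕ} {f g : (Fin k → ZMod q) → ZMod q}
    (h : ∀ (e : Fin 3 ↪ Fin k) (y : Fin k → ZMod q),
      IsLinearTuple ![fixToCube f e y, fixToCube g e y]) :
    HasSplitCubes f ∧ HasSplitCubes g := by
  constructor
  · intro i j l hij hil hjl y
    obtain ⟨γ, β, β', s, t, hst⟩ := exists_of_isLinearTuple_fixToCube h hij hil hjl y
    exact ⟨β, _, _, _, fun a b c => (hst a b c).1⟩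
  · intro i j l hij hil hjl y
    obtain ⟨γ, β, β', s, t, hst⟩ := exists_of_isLinearTuple_fixToCube h hij hil hjl y
    exact ⟨β', _, _, _, fun a b c => (hst a b c).2⟩

theorem SplitsOnPlane.exists_mul_eq {k q : ℕ} [Fact q.Prime] {f : (Fin k → ZMod q) → ZMod q}
    (hf : IsLatinHypercube f) {δ : Equiv.Perm (ZMod q)} {i j l : Fin k}
    (hij : i ≠ j) (h : SplitsOnPlane (fun x => δ (f x)) i j 0)
    (β : Equiv.Perm (ZMod q)) (A B C : ZMod q → ZMod q)
    (hβ : ∀ a b c, β (f (update (update (update (0 : Fin k → ZMod q) i a) j b) l c)) =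
      A a + B b + C c)
    (hil : i ≠ l) (hjl : j ≠ l) :
    ∃ s, s ≠ 0 ∧ ∀ a, s * (δ (f (update (0 : Fin k → ZMod q) i a)) - δ (f 0)) = A a - A 0 := by
  have hl : ∀ a b : ZMod q, update (update (update (0 : Fin k → ZMod q) i a) j b) l 0 =
      update (update (0 : Fin k → ZMod q) i a) j b := by
    intro a b
    refine update_eq_self_iff.2 ?_
    simp [Function.update_of_ne hil.symm, Function.update_of_ne hjl.symm]
  have hβ' : ∀ a b, β (f (update (update (0 : Fin k → ZMod q) i a) j b)) = A a + (B b + C 0) := by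
    intro a b
    rw [← hl, hβ, add_assoc]
  obtain ⟨s, c, hs, hsc⟩ := h.exists_affine (hf.perm_comp δ) hij (δ.symm.trans β) A
    (fun b => B b + C 0) (by simpa using hβ')
  refine ⟨s, hs, fun a => ?_⟩
  have hj : ∀ a : ZMod q, update (update (0 : Fin k → ZMod q) i a) j 0 =
      update (0 : Fin k → ZMod q) i a := fun a =>
    update_eq_self_iff.2 (by simp [Function.update_of_ne hij.symm])
  have h1 : ∀ a, s * δ (f (update (0 : Fin k → ZMod q) i a)) + c = A a + (B 0 + C 0) := by
    intro a
    rw [← hsc, ← hβ', hj]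
    simp
  have h2 := h1 0
  rw [show update (0 : Fin k → ZMod q) i 0 = 0 from update_eq_self_iff.2 rfl] at h2
  linear_combination h1 a - h2

/-- The one-variable parts of two split hypercubes forming linear pairs of cubes are
proportional. -/
theorem exists_eq_mul_of_linear_cubes {k q : ℕ} [Fact q.Prime] (hk : 3 ≤ k)
    {f g : (Fin k → ZMod q) → ZMod q} (hf : IsLatinHypercube f) (hg : IsLatinHypercube g)
    (h : ∀ (e : Fin 3 ↪ Fin k) (y : Fin k → ZMod q),
      IsLinearTuple ![fixToCube f e y, fixToCube g e y])
    {δ ε : Equiv.Perm (ZMod q)}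
    (hδ : ∀ i j, i ≠ j → ∀ y, SplitsOnPlane (fun x => δ (f x)) i j y)
    (hε : ∀ i j, i ≠ j → ∀ y, SplitsOnPlane (fun x => ε (g x)) i j y) (i : Fin k) :
    ∃ c, c ≠ 0 ∧ ∀ a, ε (g (update 0 i a)) - ε (g 0) =
      c * (δ (f (update 0 i a)) - δ (f 0)) := by
  obtain ⟨j, l, hij, hil, hjl⟩ : ∃ j l : Fin k, i ≠ j ∧ i ≠ l ∧ j ≠ l := by
    obtain ⟨j, hj⟩ := Finset.exists_mem_notMem_of_card_lt_card
      (s := {i}) (t := (Finset.univ : Finset (Fin k))) (by simp; omega)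
    obtain ⟨l, hl⟩ := Finset.exists_mem_notMem_of_card_lt_card
      (s := {i, j}) (t := (Finset.univ : Finset (Fin k)))
      ((Finset.card_le_two).trans_lt (by simp; omega))
    simp only [Finset.mem_univ, Finset.mem_insert, Finset.mem_singleton, true_and, not_or]
      at hj hl
    exact ⟨j, l, Ne.symm hj, Ne.symm hl.1, Ne.symm hl.2⟩
  obtain ⟨γ, β, β', u, v, huv⟩ := exists_of_isLinearTuple_fixToCube h hij hil hjl 0
  obtain ⟨s, hs, hsA⟩ := (hδ i j hij 0).exists_mul_eq hf hij β (fun a => u 0 * γ 0 a) _ _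
    (fun a b c => (huv a b c).1) hil hjl
  obtain ⟨t, ht, htA⟩ := (hε i j hij 0).exists_mul_eq hg hij β' (fun a => v 0 * γ 0 a) _ _
    (fun a b c => (huv a b c).2) hil hjl
  have ne_zero : ∀ {f' : (Fin k → ZMod q) → ZMod q} {δ' : Equiv.Perm (ZMod q)} {s' w : ZMod q},
      IsLatinHypercube f' → s' ≠ 0 →
      (∀ a, s' * (δ' (f' (update 0 i a)) - δ' (f' 0)) = w * γ 0 a - w * γ 0 0) → w ≠ 0 := by
    intro f' δ' s' w hf' hs' hw hw0
    have h1 := hw 1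
    rw [hw0] at h1
    simp only [zero_mul, sub_zero, mul_eq_zero, hs', false_or, sub_eq_zero] at h1
    have h2 := δ'.injective h1
    rw [← show update (0 : Fin k → ZMod q) i 0 = 0 from update_eq_self_iff.2 rfl,
      update_idem] at h2
    exact one_ne_zero ((hf' i 0).1 h2)
  have hu := ne_zero hf hs hsA
  have hv := ne_zero hg ht htA
  refine ⟨t⁻¹ * v 0 * (u 0)⁻¹ * s, by simp [hs, ht, hu, hv], fun a => ?_⟩
  have h1 := hsA a
  have h2 := htA a
  field_simp
  linear_combination u 0 * h2 - v 0 * h1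

/-- If every pair of Latin cubes obtained from two hypercubes of an `r`-tuple of Latin
hypercubes of prime order and dimension `k ≥ 4` by fixing the same `k - 3` arguments is
linear, then the whole `r`-tuple is linear. -/
theorem tuple_linear_of_cube_pairs_linear (q r k : ℕ) [Fact q.Prime]
    (hr : 2 ≤ r) (hk : 4 ≤ k)
    (f : Fin r → (Fin k → ZMod q) → ZMod q)
    (hlatin : ∀ i, IsLatinHypercube (f i))
    (hcubes : ∀ i₁ i₂ : Fin r, i₁ < i₂ →
      ∀ (e : Fin 3 ↪ Fin k) (y : Fin k → ZMod q),
        IsLinearTuple ![fixToCube (f i₁) e y, fixToCube (f i₂) e y]) :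
    IsLinearTuple f := by
  let o : Fin r := ⟨0, by omega⟩
  have ho : ∀ i, i ≠ o → o < i := fun i hi =>
    lt_of_le_of_ne (Fin.le_def.2 (Nat.zero_le _)) hi.symm
  have hsplit : ∀ i, HasSplitCubes (f i) := by
    intro i
    by_cases hi : i = o
    · subst hi
      exact (hasSplitCubes_of_isLinearTuple_fixToCube
        (hcubes o ⟨1, by omega⟩ (Fin.mk_lt_mk.2 one_pos))).1
    · exact (hasSplitCubes_of_isLinearTuple_fixToCube (hcubes o i (ho i hi))).2
  choose δ hδ using fun i => exists_perm_forall_splitsOnPlane (by omega) (hlatin i) (hsplit i)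
  have hprop : ∀ i j, ∃ c, ∀ a, δ i (f i (update 0 j a)) - δ i (f i 0) =
      c * (δ o (f o (update 0 j a)) - δ o (f o 0)) := by
    intro i j
    by_cases hi : i = o
    · subst hi
      exact ⟨1, fun a => (one_mul _).symm⟩
    · obtain ⟨c, -, hc⟩ := exists_eq_mul_of_linear_cubes (by omega) (hlatin o) (hlatin i)
        (hcubes o i (ho i hi)) (hδ o) (hδ i) j
      exact ⟨c, hc⟩
  choose c hc using hprop
  refine ⟨fun j => (Equiv.ofBijective _ (((hlatin o).perm_comp (δ o)) j 0)).trans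
      (Equiv.subRight (δ o (f o 0))),
    fun i => (δ i).trans (Equiv.subRight (δ i (f i 0))), c, fun i x => ?_⟩
  have h := eq_sum_of_splitsOnPlane (hδ i) x
  rw [Finset.sum_congr rfl fun j _ => hc i j (x j)] at h
  simp only [Equiv.trans_apply, Equiv.subRight_apply, Equiv.ofBijective_apply]
  rw [h]
  ring
end

section
/- Let q be a prime power and let n ∈ {q−1, q, q+1}. Then any two linear (n, q^{n−2}, 3)_q codes, i.e., vector subspaces of F_q^n of dimension n−2 with minimum distance 3, are equivalent. -/
/-- `C` has minimum distance exactly `d`. -/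
def minDistIs {n : ℕ} {A : Type*} [DecidableEq A] (C : Set (Fin n → A)) (d : ℕ) : Prop :=
  (∀ c ∈ C, ∀ c' ∈ C, c ≠ c' → d ≤ hammingDist c c') ∧
  ∃ c ∈ C, ∃ c' ∈ C, c ≠ c' ∧ hammingDist c c' = d

/-- Two codes are equivalent if one is obtained from the other by a permutation of the
coordinates followed by a permutation of the symbols at each coordinate separately. -/
def CodeEquiv {n : ℕ} {A : Type*} (C C' : Set (Fin n → A)) : Prop :=
  ∃ (π : Equiv.Perm (Fin n)) (σ : Fin n → Equiv.Perm A),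
    C' = (fun c (j : Fin n) => σ j (c (π j))) '' C

open scoped LinearAlgebra.Projectivization

section ProjectiveLine

variable {F V V' : Type*} [Field F] [AddCommGroup V] [Module F V] [AddCommGroup V'] [Module F V']

/-- An injective family of points indexed by `Fin n` in a set with `m` elements extends to an
enumeration by `Fin m`. -/
theorem exists_equiv_extend_fin {X : Type*} {n m : ℕ} (hX : Nat.card X = m) (hm : 0 < m)
    (hnm : n ≤ m) {p : Fin n → X} (hp : Function.Injective p) :
    ∃ e : Fin m ≃ X, ∀ i, e (Fin.castLE hnm i) = p i := by
  have : Finite X := Nat.finite_of_card_ne_zero (by omega)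
  let e₀ : Fin m ≃ X := (Finite.equivFinOfCardEq hX).symm
  obtain ⟨σ, hσ⟩ := Equiv.Perm.exists_extending_pair (Fin.castLE hnm) (e₀.symm ∘ p)
    (Fin.castLE_injective hnm) (e₀.symm.injective.comp hp)
  refine ⟨σ.trans e₀, fun i => ?_⟩
  simp [hσ]

/-- A linear isomorphism between planes can be chosen to carry two given distinct points of the
projective line to two given distinct points. -/
theorem exists_linearEquiv_map_pair (hV : Module.finrank F V = 2) (hV' : Module.finrank F V' = 2)
    {x y : ℙ F V} (hxy : x ≠ y) {x' y' : ℙ F V'} (hxy' : x' ≠ y') :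
    ∃ A : V ≃ₗ[F] V', Projectivization.map A.toLinearMap A.injective x = x' ∧
      Projectivization.map A.toLinearMap A.injective y = y' := by
  let b := basisOfLinearIndependentOfCardEqFinrank
    (Projectivization.linearIndependent_pair_iff_ne.2 hxy) (by simp [hV])
  let b' := basisOfLinearIndependentOfCardEqFinrank
    (Projectivization.linearIndependent_pair_iff_ne.2 hxy') (by simp [hV'])
  have hA (i : Fin 2) : b.equiv b' (Equiv.refl _) (![x.rep, y.rep] i) = ![x'.rep, y'.rep] i := by
    have := b.equiv_apply i b' (Equiv.refl _)
    simpa [b, b'] using this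
  refine ⟨b.equiv b' (Equiv.refl _), ?_, ?_⟩
  · have h := hA 0
    conv_lhs => rw [← x.mk_rep]
    conv_rhs => rw [← x'.mk_rep]
    rw [Projectivization.map_mk]
    congr 1
  · have h := hA 1
    conv_lhs => rw [← y.mk_rep]
    conv_rhs => rw [← y'.mk_rep]
    rw [Projectivization.map_mk]
    congr 1

/-- Any two sets of points of the same size, missing at most two points of the projective line,
are projectively equivalent. -/
theorem exists_linearEquiv_perm_of_injective [Fintype F] {n : ℕ}
    (hn : Fintype.card F ≤ n + 1) (hV : Module.finrank F V = 2) (hV' : Module.finrank F V' = 2)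
    {p : Fin n → ℙ F V} (hp : Function.Injective p)
    {p' : Fin n → ℙ F V'} (hp' : Function.Injective p') :
    ∃ (A : V ≃ₗ[F] V') (π : Equiv.Perm (Fin n)),
      ∀ j, Projectivization.map A.toLinearMap A.injective (p (π j)) = p' j := by
  have hF : 1 < Fintype.card F := Fintype.one_lt_card
  have hc : Nat.card (ℙ F V) = Fintype.card F + 1 := by
    rw [Projectivization.card_of_finrank_two F V hV, Nat.card_eq_fintype_card]
  have hc' : Nat.card (ℙ F V') = Fintype.card F + 1 := by
    rw [Projectivization.card_of_finrank_two F V' hV', Nat.card_eq_fintype_card]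
  have : Finite (ℙ F V) := Nat.finite_of_card_ne_zero (by omega)
  have hnm : n ≤ Fintype.card F + 1 := by
    simpa [hc] using Nat.card_le_card_of_injective p hp
  obtain ⟨e, he⟩ := exists_equiv_extend_fin hc (by omega) hnm hp
  obtain ⟨e', he'⟩ := exists_equiv_extend_fin hc' (by omega) hnm hp'
  let a : Fin (Fintype.card F + 1) := ⟨Fintype.card F - 1, by omega⟩
  let b : Fin (Fintype.card F + 1) := ⟨Fintype.card F, by omega⟩
  have hab : a ≠ b := by simp only [a, b, ne_eq, Fin.mk.injEq]; omega
  obtain ⟨A, hAa, hAb⟩ := exists_linearEquiv_map_pair hV hV' (e.injective.ne hab)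
    (e'.injective.ne hab)
  let g (i : Fin (Fintype.card F + 1)) : Fin (Fintype.card F + 1) :=
    e'.symm (Projectivization.map A.toLinearMap A.injective (e i))
  have hg : Function.Injective g := e'.symm.injective.comp
    ((Projectivization.map_injective (τ := RingHom.id F) A.toLinearMap A.injective).comp
      e.injective)
  have hga : g a = a := by simp [g, hAa]
  have hgb : g b = b := by simp [g, hAb]
  have hlt (i : Fin n) : (g (Fin.castLE hnm i) : ℕ) < n := by
    by_contra! h
    have hi : (g (Fin.castLE hnm i)) = Fin.castLE hnm i := by
      have : g (Fin.castLE hnm i) = a ∨ g (Fin.castLE hnm i) = b := by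
        simp only [a, b, Fin.ext_iff]
        omega
      rcases this with h | h
      · rw [h, hg (h.trans hga.symm)]
      · rw [h, hg (h.trans hgb.symm)]
    rw [hi] at h
    exact absurd i.2 h.not_gt
  let f (i : Fin n) : Fin n := ⟨g (Fin.castLE hnm i), hlt i⟩
  have hf : Function.Injective f := fun i j hij =>
    Fin.castLE_injective hnm (hg (Fin.ext (by simpa [f] using hij)))
  let ρ : Equiv.Perm (Fin n) := Equiv.ofBijective f (Finite.injective_iff_bijective.1 hf)
  have hρ (i : Fin n) :
      Projectivization.map A.toLinearMap A.injective (p i) = p' (ρ i) := by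
    have : Fin.castLE hnm (ρ i) = g (Fin.castLE hnm i) := rfl
    rw [← he', this, ← he]
    simp [g]
  exact ⟨A, ρ.symm, fun j => by simp [hρ]⟩

end ProjectiveLine

section Code

variable {F : Type*} [Field F] {n : ℕ}

theorem mkQ_eq_sum_smul_single (D : Submodule F (Fin n → F)) (c : Fin n → F) :
    D.mkQ c = ∑ j, c j • D.mkQ (Pi.single j 1) := by
  conv_lhs => rw [pi_eq_sum_univ' c]
  simp only [map_sum, map_smul]

/-- Codes whose parity check columns agree up to a linear isomorphism, a permutation and nonzero
scalars are equivalent. -/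
theorem codeEquiv_of_mkQ_single {D₁ D₂ : Submodule F (Fin n → F)}
    (A : ((Fin n → F) ⧸ D₁) ≃ₗ[F] ((Fin n → F) ⧸ D₂)) (π : Equiv.Perm (Fin n)) (u : Fin n → Fˣ)
    (h : ∀ j, u j • D₂.mkQ (Pi.single j 1) = A (D₁.mkQ (Pi.single (π j) 1))) :
    CodeEquiv (D₁ : Set (Fin n → F)) (D₂ : Set (Fin n → F)) := by
  refine ⟨π, fun j => Units.mulRight (u j), ?_⟩
  have key (c : Fin n → F) : (fun j => c (π j) * u j) ∈ D₂ ↔ c ∈ D₁ := by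
    have : D₂.mkQ (fun j => c (π j) * u j) = A (D₁.mkQ c) := by
      rw [mkQ_eq_sum_smul_single D₂, mkQ_eq_sum_smul_single D₁, map_sum,
        ← Equiv.sum_comp π fun i => A (c i • _)]
      refine Finset.sum_congr rfl fun j _ => ?_
      rw [map_smul, ← h, Units.smul_def, smul_smul]
    rw [← Submodule.Quotient.mk_eq_zero D₂, ← Submodule.Quotient.mk_eq_zero D₁,
      ← Submodule.mkQ_apply, this, A.map_eq_zero_iff, Submodule.mkQ_apply]
  ext c'
  simp only [SetLike.mem_coe, Set.mem_image, Units.mulRight_apply]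
  constructor
  · intro hc'
    have hc : (fun j => (c' (π.symm (π j)) * ↑(u (π.symm (π j)))⁻¹) * (u j : F)) = c' := by
      ext j
      simp
    exact ⟨fun i => c' (π.symm i) * ↑(u (π.symm i))⁻¹, (key _).1 (by rwa [hc]), hc⟩
  · rintro ⟨c, hc, rfl⟩
    exact (key c).2 hc

variable [DecidableEq F] {D : Submodule F (Fin n → F)}

theorem le_hammingNorm_of_minDistIs {d : ℕ} (hmin : minDistIs (D : Set (Fin n → F)) d)
    {c : Fin n → F} (hc : c ∈ D) (hc0 : c ≠ 0) : d ≤ hammingNorm c := by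
  simpa using hmin.1 c hc 0 D.zero_mem hc0

theorem hammingNorm_le_two_of_support {i j : Fin n} {c : Fin n → F}
    (h : ∀ k, k ≠ i → k ≠ j → c k = 0) : hammingNorm c ≤ 2 := by
  refine (Finset.card_le_card (t := {i, j}) fun k hk => ?_).trans Finset.card_le_two
  by_contra hk'
  simp only [Finset.mem_insert, Finset.mem_singleton, not_or] at hk'
  exact (Finset.mem_filter.1 hk).2 (h k hk'.1 hk'.2)

/-- The columns of a parity check matrix of a code of minimum distance `3` are nonzero. -/
theorem mkQ_single_ne_zero (hmin : minDistIs (D : Set (Fin n → F)) 3) (i : Fin n) :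
    D.mkQ (Pi.single i 1) ≠ 0 := by
  intro h
  have h1 := le_hammingNorm_of_minDistIs hmin
    (by simpa using h : (Pi.single i 1 : Fin n → F) ∈ D) (by simp)
  have h2 := hammingNorm_le_two_of_support (i := i) (j := i) (c := (Pi.single i 1 : Fin n → F))
    (fun k hk _ => by simp [hk])
  omega

/-- The columns of a parity check matrix of a code of minimum distance `3` are projectively
distinct. -/
theorem injective_mk_mkQ_single (hmin : minDistIs (D : Set (Fin n → F)) 3) :
    Function.Injective fun i => Projectivization.mk F _ (mkQ_single_ne_zero hmin i) := by
  intro i j hij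
  by_contra hne
  obtain ⟨a, ha⟩ := (Projectivization.mk_eq_mk_iff' F _ _ _ _).1 hij
  rw [← map_smul, ← sub_eq_zero, ← map_sub, Submodule.mkQ_apply, Submodule.Quotient.mk_eq_zero]
    at ha
  have h1 := le_hammingNorm_of_minDistIs hmin ha
    (fun h => by simpa [hne] using congrFun h i)
  have h2 := hammingNorm_le_two_of_support (i := i) (j := j)
    (c := a • (Pi.single j 1 : Fin n → F) - Pi.single i 1)
    (fun k hk hk' => by simp [hk, hk'])
  omega

theorem finrank_quotient_eq_two (hdim : Module.finrank F D = n - 2)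
    (hmin : minDistIs (D : Set (Fin n → F)) 3) :
    Module.finrank F ((Fin n → F) ⧸ D) = 2 := by
  have h := D.finrank_quotient_add_finrank
  obtain ⟨c, -, c', -, -, hcc⟩ := hmin.2
  have hle := hammingDist_le_card_fintype (x := c) (y := c')
  simp only [Module.finrank_fin_fun, Fintype.card_fin] at h hle
  omega

end Code

/-- For a prime power `q` (realized as the cardinality of a finite field `F`) and
`n ∈ {q-1, q, q+1}`, all linear `(n, q^(n-2), 3)_q` codes, i.e. subspaces of `F^n` of
dimension `n-2` with minimum distance `3`, are equivalent. -/
theorem linear_codes_equivalent {F : Type*} [Field F] [Fintype F] [DecidableEq F]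
    (q n : ℕ) (hq : Fintype.card F = q)
    (hn : n = q - 1 ∨ n = q ∨ n = q + 1)
    (D₁ D₂ : Submodule F (Fin n → F))
    (hdim₁ : Module.finrank F D₁ = n - 2) (hmin₁ : minDistIs (D₁ : Set (Fin n → F)) 3)
    (hdim₂ : Module.finrank F D₂ = n - 2) (hmin₂ : minDistIs (D₂ : Set (Fin n → F)) 3) :
    CodeEquiv (D₁ : Set (Fin n → F)) (D₂ : Set (Fin n → F)) := by
  obtain ⟨A, π, hA⟩ := exists_linearEquiv_perm_of_injective (by omega)
    (finrank_quotient_eq_two hdim₁ hmin₁) (finrank_quotient_eq_two hdim₂ hmin₂)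
    (injective_mk_mkQ_single hmin₁) (injective_mk_mkQ_single hmin₂)
  have hu (j : Fin n) : ∃ u : Fˣ,
      u • D₂.mkQ (Pi.single j 1) = A (D₁.mkQ (Pi.single (π j) 1)) :=
    (Projectivization.mk_eq_mk_iff F _ _ _ _).1 (hA j)
  choose u hu using hu
  exact codeEquiv_of_mkQ_single A π u hu
end

section
/- Let q ≥ 2 and n ≥ 2, let Ĉ ⊆ F_q^n be an (n, q^{n−2}, 3)_q code and D̂ ⊆ F_q^{n−1} an (n−1, q^{n−3}, 3)_q code, and let C ⊆ F_q^n be a code equivalent to Ĉ such that s(C,1,0) = D̂. Then there exist a coordinate i ∈ {1,…,n}, a value v ∈ F_q, an element g ∈ G_{n−1} with g(s(h_{i,v}Ĉ, 1, 0)) = D̂, and an element g' ∈ G_n whose coordinate permutation is the identity, whose symbol permutations in coordinates 2,…,n are the identity, and whose symbol permutation in coordinate 1 fixes 0, such that C = g'·(e(g,1))·(h_{i,v}·Ĉ). -/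
/-- The action of the group element `g = (π; σ₁, …, σ_n) ∈ G_n` on a word:
`(gc)_{π(i)} = σ_{π(i)}(c_i)`, i.e. `(gc)_j = σ_j(c_{π⁻¹(j)})`. -/
def actWord {n : ℕ} {A : Type*} (π : Equiv.Perm (Fin n)) (σ : Fin n → Equiv.Perm A)
    (c : Fin n → A) : Fin n → A :=
  fun j => σ j (c (π.symm j))

/-- The action of `g = (π; σ₁, …, σ_n) ∈ G_n` on a code. -/
def actCode {n : ℕ} {A : Type*} (π : Equiv.Perm (Fin n)) (σ : Fin n → Equiv.Perm A)
    (C : Set (Fin n → A)) : Set (Fin n → A) :=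
  actWord π σ '' C

/-- The shortened code `s(C, i, v)`. -/
def shorten {n : ℕ} {A : Type*} (C : Set (Fin (n + 1) → A)) (i : Fin (n + 1)) (v : A) :
    Set (Fin n → A) :=
  {c' | ∃ c ∈ C, c i = v ∧ c' = fun j => c (i.succAbove j)}

/-- The element `h_{i,v} ∈ G_{n+1}`: apply the cyclic permutation `(0 1 ⋯ i)` to the
coordinates and then swap the values `v` and `0` in the first coordinate. Its coordinate
permutation is `Fin.cycleRange i` (so that the content of coordinate `i` is moved to the
first coordinate) and its symbol permutation at the first coordinate is `swap v 0`. -/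
def hAct {n q : ℕ} (i : Fin (n + 1)) (v : ZMod q) (C : Set (Fin (n + 1) → ZMod q)) :
    Set (Fin (n + 1) → ZMod q) :=
  actCode (Fin.cycleRange i) (fun j => if j = 0 then Equiv.swap v 0 else 1) C

/-- The element `e(g, 1) ∈ G_{n+1}` obtained from `g = (π; σ) ∈ G_n`: it applies `g` to
the coordinates other than the first one and keeps the first coordinate intact, so that
`e(gC, 1, v) = e(g, 1) e(C, 1, v)`. -/
def eAct {n : ℕ} {A : Type*} (π : Equiv.Perm (Fin n)) (σ : Fin n → Equiv.Perm A)
    (C : Set (Fin (n + 1) → A)) : Set (Fin (n + 1) → A) :=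
  actCode (Equiv.Perm.decomposeFin.symm (0, π)) (Fin.cons 1 σ) C

theorem decomposeFin_symm_zero_symm_zero {n : ℕ} (ρ : Equiv.Perm (Fin n)) :
    (Equiv.Perm.decomposeFin.symm (0, ρ)).symm 0 = 0 := by
  simp [Equiv.symm_apply_eq]

theorem decomposeFin_symm_zero_symm_succ {n : ℕ} (ρ : Equiv.Perm (Fin n)) (j : Fin n) :
    (Equiv.Perm.decomposeFin.symm (0, ρ)).symm j.succ = (ρ.symm j).succ := by
  simp [Equiv.symm_apply_eq]

theorem actWord_actWord {n : ℕ} {A : Type*} (π ρ : Equiv.Perm (Fin n))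
    (σ τ : Fin n → Equiv.Perm A) (c : Fin n → A) :
    actWord π σ (actWord ρ τ c) = actWord (π * ρ) (fun j => σ j * τ (π.symm j)) c :=
  rfl

theorem actCode_actCode {n : ℕ} {A : Type*} (π ρ : Equiv.Perm (Fin n))
    (σ τ : Fin n → Equiv.Perm A) (C : Set (Fin n → A)) :
    actCode π σ (actCode ρ τ C) = actCode (π * ρ) (fun j => σ j * τ (π.symm j)) C := by
  simp only [actCode, Set.image_image, actWord_actWord]

/-- Relabelling the first coordinate by a permutation fixing `a` does not change the code
shortened at the value `a` there. -/
theorem shorten_actCode_one_cons {n : ℕ} {A : Type*} (τ : Equiv.Perm A) {a : A} (h : τ a = a)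
    (C : Set (Fin (n + 1) → A)) :
    shorten (actCode 1 (Fin.cons τ 1) C) 0 a = shorten C 0 a := by
  have hτ (x : A) : τ x = a ↔ x = a := by rw [← τ.apply_eq_iff_eq (x := x) (y := a), h]
  ext w
  simp [shorten, actCode, actWord, Equiv.Perm.one_def, hτ]

theorem shorten_eAct {n : ℕ} {A : Type*} (π : Equiv.Perm (Fin n)) (σ : Fin n → Equiv.Perm A)
    (C : Set (Fin (n + 1) → A)) (a : A) :
    shorten (eAct π σ C) 0 a = actCode π σ (shorten C 0 a) := by
  ext w
  constructor
  · rintro ⟨_, ⟨c, hc, rfl⟩, h0, rfl⟩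
    refine ⟨_, ⟨c, hc, ?_, rfl⟩, ?_⟩
    · simpa [actWord, decomposeFin_symm_zero_symm_zero] using h0
    · ext j
      simp [actWord, decomposeFin_symm_zero_symm_succ]
  · rintro ⟨_, ⟨c, hc, h0, rfl⟩, rfl⟩
    refine ⟨_, ⟨c, hc, rfl⟩, ?_, ?_⟩
    · simpa [actWord, decomposeFin_symm_zero_symm_zero] using h0
    · ext j
      simp [actWord, decomposeFin_symm_zero_symm_succ]

/-- A coordinate permutation sending `i` to the first coordinate is the cyclic permutation
`(0 1 ⋯ i)` followed by a permutation of the remaining coordinates. -/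
theorem exists_eq_decomposeFin_symm_mul_cycleRange {n : ℕ} (π : Equiv.Perm (Fin (n + 1)))
    {i : Fin (n + 1)} (hi : π i = 0) :
    ∃ ρ : Equiv.Perm (Fin n), π = Equiv.Perm.decomposeFin.symm (0, ρ) * Fin.cycleRange i := by
  obtain ⟨⟨p, ρ⟩, h⟩ := Equiv.Perm.decomposeFin.symm.surjective (π * (Fin.cycleRange i)⁻¹)
  have h0 := congrArg (fun τ : Equiv.Perm (Fin (n + 1)) => τ 0) h
  obtain rfl : p = 0 := by
    simpa [Equiv.Perm.inv_def, Fin.cycleRange_symm_zero, hi] using h0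
  exact ⟨ρ, by rw [h, inv_mul_cancel_right]⟩

/-- Let `Ĉ` be an `(n+1, q^(n-1), 3)_q` code and `D̂` an `(n, q^(n-2), 3)_q` code, and let
`C` be a code equivalent to `Ĉ` with `s(C, 1, 0) = D̂`. Then `C = g' e(g,1) h_{i,v} Ĉ`
where `g'` only permutes the nonzero values of the first coordinate, `(i, v)` is a
coordinate–value pair, and `g ∈ Iso(s(h_{i,v} Ĉ, 1, 0), D̂)`. -/
theorem equivalent_code_decomposition (q n : ℕ) (hq : 2 ≤ q) (hn : 1 ≤ n)
    (Chat : Set (Fin (n + 1) → ZMod q))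
    (hChat : Chat.ncard = q ^ (n - 1) ∧ minDistIs Chat 3)
    (Dhat : Set (Fin n → ZMod q))
    (hDhat : Dhat.ncard = q ^ (n - 2) ∧ minDistIs Dhat 3)
    (C : Set (Fin (n + 1) → ZMod q))
    (hCequiv : ∃ (π : Equiv.Perm (Fin (n + 1))) (σ : Fin (n + 1) → Equiv.Perm (ZMod q)),
      C = actCode π σ Chat)
    (hCshort : shorten C 0 0 = Dhat) :
    ∃ (i : Fin (n + 1)) (v : ZMod q)
      (g : Equiv.Perm (Fin n) × (Fin n → Equiv.Perm (ZMod q)))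
      (σ₁ : Equiv.Perm (ZMod q)),
      actCode g.1 g.2 (shorten (hAct i v Chat) 0 0) = Dhat ∧
      σ₁ 0 = 0 ∧
      C = actCode 1 (Fin.cons σ₁ 1) (eAct g.1 g.2 (hAct i v Chat)) := by
  obtain ⟨π, σ, rfl⟩ := hCequiv
  obtain ⟨ρ, hρ⟩ := exists_eq_decomposeFin_symm_mul_cycleRange π (π.apply_symm_apply 0)
  set i := π.symm 0
  set v := (σ 0).symm 0 with hv
  set σ₁ : Equiv.Perm (ZMod q) := σ 0 * Equiv.swap v 0
  have hσ₁ : σ₁ 0 = 0 := by simp [σ₁, hv]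
  have key : actCode π σ Chat =
      actCode 1 (Fin.cons σ₁ 1) (eAct ρ (fun j => σ j.succ) (hAct i v Chat)) := by
    simp only [eAct, hAct, actCode_actCode, one_mul, ← hρ]
    congr 1
    funext j
    ext x : 1
    refine Fin.cases ?_ (fun j => ?_) j
    · simp [σ₁, Equiv.Perm.one_def, decomposeFin_symm_zero_symm_zero]
    · simp [Equiv.Perm.one_def, decomposeFin_symm_zero_symm_succ]
  refine ⟨i, v, (ρ, fun j => σ j.succ), σ₁, ?_, hσ₁, key⟩
  rw [← hCshort, key, shorten_actCode_one_cons σ₁ hσ₁, shorten_eAct]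
end

section
/- There exists a (9, 8^7, 3)_8 code over F_8, i.e., a perfect one-error-correcting 8-ary MDS code of length 9 and size 8^7, that is not equivalent to any linear code (any vector subspace of F_8^9). -/
/-- The symbols of the code, the vectors of `𝔽₂³`. -/
abbrev Octal : Type := ZMod 2 × ZMod 2 × ZMod 2

/-- The images of the standard basis of `𝔽₂³` under the nine linear maps `𝔽₂³ → 𝔽₂⁹` that make up
the syndrome map of the code. -/
def syndromeColumn : Fin 9 → Fin 3 → Octal × Octal × Octal :=
  ![![((1, 0, 0), (0, 0, 0), (0, 0, 0)), ((0, 1, 0), (0, 0, 0), (0, 0, 0)),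
      ((0, 0, 1), (0, 0, 0), (0, 0, 0))],
    ![((0, 0, 0), (1, 0, 0), (0, 0, 0)), ((0, 0, 0), (0, 1, 0), (0, 0, 0)),
      ((0, 0, 0), (0, 0, 1), (0, 0, 0))],
    ![((1, 0, 0), (1, 0, 0), (0, 1, 0)), ((0, 1, 0), (0, 1, 0), (0, 1, 1)),
      ((0, 0, 1), (0, 0, 1), (0, 1, 1))],
    ![((1, 0, 0), (0, 1, 0), (0, 0, 1)), ((0, 1, 0), (0, 0, 1), (0, 0, 0)),
      ((0, 0, 1), (1, 1, 0), (0, 0, 0))],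
    ![((1, 0, 0), (1, 1, 0), (0, 1, 0)), ((0, 1, 0), (0, 1, 1), (0, 0, 1)),
      ((0, 0, 1), (1, 1, 1), (0, 1, 0))],
    ![((1, 0, 0), (0, 0, 1), (0, 0, 0)), ((0, 1, 0), (1, 1, 0), (0, 0, 1)),
      ((0, 0, 1), (0, 1, 1), (0, 0, 1))],
    ![((1, 0, 0), (1, 0, 1), (0, 0, 0)), ((0, 1, 0), (1, 0, 0), (0, 1, 1)),
      ((0, 0, 1), (0, 1, 0), (0, 0, 1))],
    ![((1, 0, 0), (0, 1, 1), (0, 0, 1)), ((0, 1, 0), (1, 1, 1), (0, 0, 0)),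
      ((0, 0, 1), (1, 0, 1), (0, 1, 1))],
    ![((1, 0, 0), (1, 1, 1), (1, 0, 1)), ((0, 1, 0), (1, 0, 1), (1, 0, 0)),
      ((0, 0, 1), (1, 0, 0), (1, 1, 1))]]

/-- The contribution of the symbol `s` at coordinate `i` to the syndrome. -/
def symbolSyndrome (i : Fin 9) (s : Octal) : Octal × Octal × Octal :=
  s.1 • syndromeColumn i 0 + s.2.1 • syndromeColumn i 1 + s.2.2 • syndromeColumn i 2

/-- The syndrome of a word. -/
def syndrome (x : Fin 9 → Octal) : Octal × Octal × Octal := ∑ i, symbolSyndrome i (x i)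

/-- The quadratic map whose graph is the set of syndromes of codewords. -/
def syndromeQuad (t : Octal) : Octal × Octal :=
  ((t.1 * t.2.1, t.1 * (t.2.1 + t.2.2), t.1 * t.2.2), (0, t.1 * t.2.1, t.1 * t.2.2))

/-- A perfect code over `𝔽₂³` that is not equivalent to an additive one. -/
def octalCode : Set (Fin 9 → Octal) :=
  {x | ((syndrome x).1, (syndrome x).2.1) = syndromeQuad (syndrome x).2.2}

instance : DecidablePred (· ∈ octalCode) := fun x =>
  inferInstanceAs (Decidable (((syndrome x).1, (syndrome x).2.1) = syndromeQuad (syndrome x).2.2))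

theorem symbolSyndrome_sub (i : Fin 9) (s t : Octal) :
    symbolSyndrome i (s - t) = symbolSyndrome i s - symbolSyndrome i t := by
  simp only [symbolSyndrome, Prod.fst_sub, Prod.snd_sub, sub_smul]
  abel

/-- The syndromes of words of weight one or two are not differences of codeword syndromes. -/
theorem syndromeQuad_add_sub_ne :
    ∀ i j : Fin 9, i ≠ j → ∀ u v : Octal, u ≠ 0 → ∀ t : Octal,
      syndromeQuad (t + (symbolSyndrome i u + symbolSyndrome j v).2.2) - syndromeQuad t ≠
        ((symbolSyndrome i u + symbolSyndrome j v).1,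
          (symbolSyndrome i u + symbolSyndrome j v).2.1) := by
  decide +kernel

theorem three_le_hammingDist_of_mem_octalCode {x y : Fin 9 → Octal} (hx : x ∈ octalCode)
    (hy : y ∈ octalCode) (hxy : x ≠ y) : 3 ≤ hammingDist x y := by
  by_contra! hlt
  obtain ⟨i, j, hij, hi, hsub⟩ : ∃ i j : Fin 9, i ≠ j ∧ x i ≠ y i ∧
      ∀ k, k ∉ ({i, j} : Finset (Fin 9)) → x k = y k := by
    obtain ⟨i, hi⟩ := Function.ne_iff.mp hxy
    have herase : (({k | x k ≠ y k} : Finset (Fin 9)).erase i).card ≤ 1 := by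
      rw [Finset.card_erase_of_mem (by simpa using hi)]
      change hammingDist x y - 1 ≤ 1
      omega
    obtain ⟨j, hj⟩ := Finset.card_le_one_iff_subset_singleton.mp herase
    by_cases hij : i = j
    · obtain ⟨l, hl⟩ := exists_ne i
      refine ⟨i, l, hl.symm, hi, fun k hk => ?_⟩
      by_contra hne
      have := @hj k
      simp_all
    · refine ⟨i, j, hij, hi, fun k hk => ?_⟩
      by_contra hne
      have := @hj k
      simp_all
  have hsyn : syndrome x =
      syndrome y + (symbolSyndrome i (x i - y i) + symbolSyndrome j (x j - y j)) := by
    rw [← sub_eq_iff_eq_add', syndrome, syndrome, ← Finset.sum_sub_distrib,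
      ← Finset.sum_pair (f := fun k => symbolSyndrome k (x k - y k)) hij]
    simp only [symbolSyndrome_sub]
    refine (Finset.sum_subset (Finset.subset_univ _) fun k _ hk => ?_).symm
    rw [hsub k hk, sub_self]
  refine syndromeQuad_add_sub_ne i j hij (x i - y i) (x j - y j) (sub_ne_zero.mpr hi)
    (syndrome y).2.2 ?_
  change _ = _ at hx hy
  rw [← Prod.snd_add, ← Prod.snd_add, ← hsyn, ← hx, ← hy, hsyn]
  simp

theorem symbolSyndrome_zero_index (s : Octal) : symbolSyndrome 0 s = (s, 0, 0) := by
  revert s; decide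

theorem symbolSyndrome_one_index (s : Octal) : symbolSyndrome 1 s = (0, s, 0) := by
  revert s; decide

/-- Dropping the first two coordinates is a bijection from the code onto all words. -/
theorem bijOn_tail_tail_octalCode :
    Set.BijOn (fun x : Fin 9 → Octal => (Fin.tail (Fin.tail x) : Fin 7 → Octal)) octalCode
      Set.univ := by
  have hsyn (x : Fin 9 → Octal) : syndrome x =
      (x 0, x 1, 0) + ∑ i : Fin 7, symbolSyndrome i.succ.succ (Fin.tail (Fin.tail x) i) := by
    rw [syndrome, Fin.sum_univ_succ, Fin.sum_univ_succ, ← add_assoc, symbolSyndrome_zero_index,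
      Fin.succ_zero_eq_one, symbolSyndrome_one_index]
    simp [Fin.tail]
  refine ⟨Set.mapsTo_univ _ _, fun x hx y hy hxy => ?_, fun y _ => ?_⟩
  · change _ = _ at hx hy
    dsimp only at hxy
    rw [hsyn] at hx hy
    rw [hxy] at hx
    simp only [Prod.fst_add, Prod.snd_add, zero_add] at hx hy
    rw [← hy] at hx
    obtain ⟨h0, h1⟩ := Prod.mk.inj hx
    rw [← Fin.cons_self_tail x, ← Fin.cons_self_tail y, ← Fin.cons_self_tail (Fin.tail x),
      ← Fin.cons_self_tail (Fin.tail y), hxy]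
    have h0' : x 0 = y 0 := add_right_cancel h0
    have h1' : Fin.tail x 0 = Fin.tail y 0 := add_right_cancel h1
    rw [h0', h1']
  · set r := ∑ i : Fin 7, symbolSyndrome i.succ.succ (y i) with hr
    refine ⟨Fin.cons ((syndromeQuad r.2.2).1 - r.1)
      (Fin.cons ((syndromeQuad r.2.2).2 - r.2.1) y : Fin 8 → Octal), ?_, ?_⟩
    · change _ = _
      rw [hsyn]
      simp only [Fin.tail_cons, ← hr]
      have h1 : (Fin.cons ((syndromeQuad r.2.2).1 - r.1)
        (Fin.cons ((syndromeQuad r.2.2).2 - r.2.1) y : Fin 8 → Octal) : Fin 9 → Octal) 1 =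
          (syndromeQuad r.2.2).2 - r.2.1 := rfl
      simp [h1]
    · simp

theorem ncard_octalCode : octalCode.ncard = 8 ^ 7 := by
  rw [← bijOn_tail_tail_octalCode.injOn.ncard_image, bijOn_tail_tail_octalCode.image_eq,
    Set.ncard_univ, Nat.card_eq_fintype_card, Fintype.card_fun]
  rfl

theorem minDistIs_octalCode : minDistIs octalCode 3 := by
  refine ⟨fun x hx y hy hxy => three_le_hammingDist_of_mem_octalCode hx hy hxy,
    0, by decide +kernel,
    ![(0, 1, 1), (0, 1, 1), (0, 1, 1), 0, 0, 0, 0, 0, 0], by decide +kernel,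
    by decide +kernel, by decide +kernel⟩

/-- In a code that is equivalent to a linear code in characteristic two, the coordinatewise
minority of three codewords that never take three distinct values at one coordinate is again a
codeword. -/
theorem CodeEquiv.mem_of_minority {n : ℕ} {F : Type*} [Field F] [CharP F 2]
    {C : Set (Fin n → F)} {M : Submodule F (Fin n → F)} (h : CodeEquiv C (M : Set (Fin n → F)))
    {x y z w : Fin n → F} (hx : x ∈ C) (hy : y ∈ C) (hz : z ∈ C)
    (hw : ∀ j, x j = y j ∧ w j = z j ∨ x j = z j ∧ w j = y j ∨ y j = z j ∧ w j = x j) :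
    w ∈ C := by
  obtain ⟨π, σ, hM⟩ := h
  set f : (Fin n → F) → Fin n → F := fun c j => σ j (c (π j)) with hf
  have hinj : Function.Injective f := fun c d hcd => funext fun j => by
    simpa [hf] using congrFun hcd (π.symm j)
  have hmem {c : Fin n → F} (hc : c ∈ C) : f c ∈ M := by
    rw [← SetLike.mem_coe, hM]
    exact Set.mem_image_of_mem f hc
  have hfw : f w = f x + f y + f z := by
    funext j
    simp only [hf, Pi.add_apply]
    rcases hw (π j) with ⟨h1, h2⟩ | ⟨h1, h2⟩ | ⟨h1, h2⟩ <;> rw [h1, h2]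
    · rw [CharTwo.add_self_eq_zero, zero_add]
    · rw [add_right_comm, CharTwo.add_self_eq_zero, zero_add]
    · rw [add_assoc, CharTwo.add_self_eq_zero, add_zero]
  have hwM : f w ∈ (M : Set (Fin n → F)) :=
    hfw ▸ M.add_mem (M.add_mem (hmem hx) (hmem hy)) (hmem hz)
  rw [hM] at hwM
  exact (hinj.mem_set_image).mp hwM

/-- The code violates the condition of `CodeEquiv.mem_of_minority`. -/
theorem exists_minority_notMem_octalCode :
    ∃ x ∈ octalCode, ∃ y ∈ octalCode, ∃ z ∈ octalCode, ∃ w ∉ octalCode,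
      ∀ j, x j = y j ∧ w j = z j ∨ x j = z j ∧ w j = y j ∨ y j = z j ∧ w j = x j := by
  refine ⟨0, by decide +kernel,
    ![0, (1, 0, 0), 0, (0, 1, 1), 0, (1, 1, 1), (1, 0, 0), (0, 1, 0), (0, 1, 0)],
    by decide +kernel,
    ![(1, 0, 1), (1, 0, 0), 0, (0, 1, 1), (0, 0, 1), (1, 1, 1), 0, 0, 0],
    by decide +kernel,
    ![(1, 0, 1), 0, 0, 0, (0, 0, 1), 0, (1, 0, 0), (0, 1, 0), (0, 1, 0)],
    by decide +kernel, by decide +kernel⟩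

/-- There exists a `(9, 8^7, 3)₈` code (a perfect one-error-correcting 8-ary MDS code)
that is not equivalent to any linear code. -/
theorem exists_nonlinear_perfect_8ary_MDS {F : Type*} [Field F] [Fintype F] [DecidableEq F]
    (hF : Fintype.card F = 8) :
    ∃ C : Set (Fin 9 → F),
      C.ncard = 8 ^ 7 ∧ minDistIs C 3 ∧
      ∀ M : Submodule F (Fin 9 → F), ¬ CodeEquiv C (M : Set (Fin 9 → F)) := by
  have hcard : Fintype.card Octal = Fintype.card F := hF ▸ rfl
  let e : Octal ≃ F := Fintype.equivOfCardEq hcard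
  have hinj : Function.Injective fun c : Fin 9 → Octal => e ∘ c := e.injective.comp_left
  have hdist (c d : Fin 9 → Octal) : hammingDist (e ∘ c) (e ∘ d) = hammingDist c d :=
    hammingDist_comp (fun _ => e) fun _ => e.injective
  refine ⟨(fun c => e ∘ c) '' octalCode, ?_, ⟨?_, ?_⟩, fun M hM => ?_⟩
  · rw [Set.ncard_image_of_injective _ hinj, ncard_octalCode]
  · rintro _ ⟨c, hc, rfl⟩ _ ⟨d, hd, rfl⟩ hcd
    rw [hdist]
    exact minDistIs_octalCode.1 c hc d hd fun h => hcd (h ▸ rfl)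
  · obtain ⟨c, hc, d, hd, hcd, h⟩ := minDistIs_octalCode.2
    exact ⟨_, ⟨c, hc, rfl⟩, _, ⟨d, hd, rfl⟩, hinj.ne hcd, (hdist c d).trans h⟩
  · have : CharP F 2 := by
      refine CharTwo.of_one_ne_zero_of_two_eq_zero one_ne_zero ?_
      have h8 : ((8 : ℕ) : F) = 0 := hF ▸ FiniteField.cast_card_eq_zero F
      refine pow_eq_zero_iff (n := 3) three_ne_zero |>.mp ?_
      rw [← h8]
      norm_num
    obtain ⟨x, hx, y, hy, z, hz, w, hw, hxyzw⟩ := exists_minority_notMem_octalCode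
    refine hw (hinj.mem_set_image.mp (hM.mem_of_minority (w := e ∘ w) ⟨x, hx, rfl⟩ ⟨y, hy, rfl⟩
      ⟨z, hz, rfl⟩ fun j => ?_))
    simpa only [Function.comp_apply, e.injective.eq_iff] using hxyzw j
end

section
/- Let q be a prime power, let k ≥ 1, and let f be a Latin hypercube of order q over F_q and dimension k. Then f is linear if and only if the code C_f = {(x_1,…,x_k, f(x_1,…,x_k)) : (x_1,…,x_k) ∈ F_q^k} ⊆ F_q^{k+1} is equivalent to a linear code. -/
/-- The code `C_f = {(x₁, …, x_k, f(x₁, …, x_k))}` of a Latin hypercube `f`. -/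
def codeOfLH {k : ℕ} {F : Type*} (f : (Fin k → F) → F) : Set (Fin (k + 1) → F) :=
  {w | ∃ x : Fin k → F, w = Fin.snoc x (f x)}

/-- The code `{w | w_{k+1} = w₁ + ⋯ + w_k}`. -/
def sumCode (F : Type*) [Field F] (k : ℕ) : Submodule F (Fin (k + 1) → F) where
  carrier := {w | w (Fin.last k) = ∑ j : Fin k, w j.castSucc}
  add_mem' := by
    intro a b ha hb
    simp only [Set.mem_ofPred_eq, Pi.add_apply, Finset.sum_add_distrib] at *
    rw [ha, hb]
  zero_mem' := by simp
  smul_mem' := by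
    intro c a ha
    simp only [Set.mem_ofPred_eq, Pi.smul_apply, smul_eq_mul, ← Finset.mul_sum] at *
    rw [ha]

theorem IsLinearLH.codeEquiv_sumCode {F : Type*} [Field F] {k : ℕ} {f : (Fin k → F) → F}
    (hf : IsLinearLH f) :
    CodeEquiv (codeOfLH f) (sumCode F k : Set (Fin (k + 1) → F)) := by
  obtain ⟨α0, α, h⟩ := hf
  refine ⟨1, Fin.snoc (α := fun _ => Equiv.Perm F) α α0, ?_⟩
  ext w
  constructor
  · intro (hw : w (Fin.last k) = ∑ j : Fin k, w j.castSucc)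
    refine ⟨_, ⟨fun j => (α j).symm (w j.castSucc), rfl⟩, ?_⟩
    ext j
    refine Fin.lastCases ?_ (fun j => ?_) j
    · simp [h, hw]
    · simp
  · rintro ⟨_, ⟨x, rfl⟩, rfl⟩
    change _ = _
    simp [h]

/-- A function whose graph is a linear code is a linear map. -/
theorem exists_linearMap_of_snoc_mem_iff {F : Type*} [Field F] {k : ℕ}
    (N : Submodule F (Fin (k + 1) → F)) (g : (Fin k → F) → F)
    (hN : ∀ y z, (Fin.snoc y z : Fin (k + 1) → F) ∈ N ↔ z = g y) :
    ∃ L : (Fin k → F) →ₗ[F] F, ∀ y, L y = g y := by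
  refine ⟨{ toFun := g, map_add' := fun a b => ?_, map_smul' := fun c a => ?_ }, fun _ => rfl⟩
  · symm
    rw [← hN]
    convert N.add_mem ((hN a _).2 rfl) ((hN b _).2 rfl) using 1
    ext j
    refine Fin.lastCases ?_ (fun j => ?_) j <;> simp
  · symm
    rw [← hN]
    convert N.smul_mem c ((hN a _).2 rfl) using 1
    ext j
    refine Fin.lastCases ?_ (fun j => ?_) j <;> simp

theorem IsLatinHypercube.isLinearLH_of_codeEquiv {F : Type*} [Field F] {k : ℕ}
    {f : (Fin k → F) → F} (hlatin : IsLatinHypercube f)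
    (M : Submodule F (Fin (k + 1) → F))
    (hM : CodeEquiv (codeOfLH f) (M : Set (Fin (k + 1) → F))) : IsLinearLH f := by
  obtain ⟨π, σ, hM⟩ := hM
  let τ : Fin (k + 1) → Equiv.Perm F := fun i => σ (π.symm i)
  let g : (Fin k → F) → F :=
    fun y => τ (Fin.last k) (f fun j => (τ j.castSucc).symm (y j))
  have hN : ∀ y z, (Fin.snoc y z : Fin (k + 1) → F) ∈ M.comap (LinearMap.funLeft F F π) ↔
      z = g y := by
    intro y z
    rw [Submodule.mem_comap, ← SetLike.mem_coe, hM]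
    constructor
    · rintro ⟨_, ⟨x, rfl⟩, hx⟩
      have key : ∀ i : Fin (k + 1), τ i ((Fin.snoc x (f x) : Fin (k + 1) → F) i) =
          (Fin.snoc y z : Fin (k + 1) → F) i := by
        intro i
        simpa [τ, LinearMap.funLeft_apply] using congrFun hx (π.symm i)
      have hxy : (fun j => (τ j.castSucc).symm (y j)) = x := by
        ext j
        rw [Equiv.symm_apply_eq]
        simpa using (key j.castSucc).symm
      simpa [g, hxy] using (key (Fin.last k)).symm
    · rintro rfl
      refine ⟨_, ⟨fun j => (τ j.castSucc).symm (y j), rfl⟩, ?_⟩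
      have key : ∀ i : Fin (k + 1), τ i ((Fin.snoc (fun j => (τ j.castSucc).symm (y j))
          (f fun j => (τ j.castSucc).symm (y j)) : Fin (k + 1) → F) i) =
          (Fin.snoc y (g y) : Fin (k + 1) → F) i := by
        intro i
        refine Fin.lastCases ?_ (fun j => ?_) i <;> simp [g]
      ext j
      simpa [τ, LinearMap.funLeft_apply] using key (π j)
  obtain ⟨L, hL⟩ := exists_linearMap_of_snoc_mem_iff _ g hN
  have hne : ∀ j, L (Pi.single j 1) ≠ 0 := by
    intro j h0
    have hupd : ∀ a : F, (fun i => (τ i.castSucc).symm ((Pi.single j a : Fin k → F) i)) =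
        Function.update (fun i => (τ i.castSucc).symm 0) j ((τ j.castSucc).symm a) := by
      intro a
      ext i
      rcases eq_or_ne i j with rfl | hij
      · simp
      · simp [hij]
    have h01 : g (Pi.single j 1) = g (Pi.single j 0) := by
      rw [← hL, ← hL, h0, Pi.single_zero, map_zero]
    have := (τ (Fin.last k)).injective h01
    rw [hupd, hupd] at this
    exact one_ne_zero ((τ j.castSucc).symm.injective ((hlatin j _).1 this))
  refine ⟨τ (Fin.last k), fun j => (τ j.castSucc).trans (Equiv.mulRight₀ _ (hne j)), fun x => ?_⟩
  have hx : τ (Fin.last k) (f x) = L fun j => τ j.castSucc (x j) := by simp [hL, g]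
  rw [hx, LinearMap.pi_apply_eq_sum_univ]
  refine Finset.sum_congr rfl fun j _ => ?_
  change τ j.castSucc (x j) * _ = τ j.castSucc (x j) * L (Pi.single j 1)
  congr 2
  ext i
  simp [Pi.single_apply, eq_comm]

/-- A Latin hypercube `f` of prime power order `q` (the order of a finite field `F`) is
linear if and only if the corresponding `(k+1, q^k, 2)_q` code `C_f` is equivalent to a
linear code. -/
theorem latinHypercube_linear_iff_code_linear
    {F : Type*} [Field F] [Fintype F] (q k : ℕ) (hF : Fintype.card F = q) (hk : 1 ≤ k)
    (f : (Fin k → F) → F) (hlatin : IsLatinHypercube f) :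
    IsLinearLH f ↔
      ∃ M : Submodule F (Fin (k + 1) → F),
        CodeEquiv (codeOfLH f) (M : Set (Fin (k + 1) → F)) := by
  exact ⟨fun hf => ⟨sumCode F k, hf.codeEquiv_sumCode⟩,
    fun ⟨M, hM⟩ => hlatin.isLinearLH_of_codeEquiv M hM⟩
end

section
/- Let q ≥ 2 and n ≥ 3, and let Ĉ_1, Ĉ_2, …, Ĉ_N be a sequence of (n, q^{n−2}, 3)_q codes over F_q, each containing the all-zero codeword, containing exactly one representative from each equivalence class of (n, q^{n−2}, 3)_q codes; let φ map each (n, q^{n−2}, 3)_q code C to the unique index φ(C) ∈ {1,…,N} with C equivalent to Ĉ_{φ(C)}. Then every (n+1, q^{n−1}, 3)_q code over F_q is equivalent to a code C ⊆ F_q^{n+1} satisfying: (1) C has minimum distance 3; (2) s(C,1,0) = Ĉ_k for some k ∈ {1,…,N}; and (3) for all i ∈ {1,…,n+1} and v ∈ F_q for which s(C,i,v) has q^{n−2} codewords, φ(s(C,i,v)) ≥ k. -/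
theorem hammingDist_comp_perm {n : ℕ} {A : Type*} [DecidableEq A] (π : Equiv.Perm (Fin n))
    (σ : Fin n → Equiv.Perm A) (c c' : Fin n → A) :
    hammingDist (fun j => σ j (c (π j))) (fun j => σ j (c' (π j))) = hammingDist c c' := by
  simp only [hammingDist, Finset.card_filter, ne_eq, EmbeddingLike.apply_eq_iff_eq]
  exact Equiv.sum_comp π fun i => if ¬c i = c' i then 1 else 0

theorem hammingDist_succAbove {n : ℕ} {A : Type*} [DecidableEq A] (i : Fin (n + 1))
    {c c' : Fin (n + 1) → A} (h : c i = c' i) :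
    hammingDist (fun j => c (i.succAbove j)) (fun j => c' (i.succAbove j)) =
      hammingDist c c' := by
  simp only [hammingDist, Finset.card_filter]
  rw [Fin.sum_univ_succAbove _ i]
  simp [h]

theorem injective_comp_perm {n : ℕ} {A : Type*} (π : Equiv.Perm (Fin n))
    (σ : Fin n → Equiv.Perm A) :
    Function.Injective (fun (c : Fin n → A) (j : Fin n) => σ j (c (π j))) := by
  intro c c' h
  ext j
  simpa using congrFun h (π.symm j)

theorem CodeEquiv.trans {n : ℕ} {A : Type*} {C D E : Set (Fin n → A)}
    (h : CodeEquiv C D) (h' : CodeEquiv D E) : CodeEquiv C E := by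
  obtain ⟨π, σ, rfl⟩ := h
  obtain ⟨ρ, τ, rfl⟩ := h'
  exact ⟨ρ.trans π, fun j => (σ (ρ j)).trans (τ j), by rw [Set.image_image]; rfl⟩

theorem CodeEquiv.ncard_eq {n : ℕ} {A : Type*} {C D : Set (Fin n → A)}
    (h : CodeEquiv C D) : D.ncard = C.ncard := by
  obtain ⟨π, σ, rfl⟩ := h
  exact Set.ncard_image_of_injective _ (injective_comp_perm π σ)

theorem CodeEquiv.minDistIs {n d : ℕ} {A : Type*} [DecidableEq A] {C D : Set (Fin n → A)}
    (h : CodeEquiv C D) (hC : minDistIs C d) : minDistIs D d := by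
  obtain ⟨π, σ, rfl⟩ := h
  obtain ⟨hle, c, hc, c', hc', hne, hd⟩ := hC
  refine ⟨?_, _, Set.mem_image_of_mem _ hc, _, Set.mem_image_of_mem _ hc',
    (injective_comp_perm π σ).ne hne, by rw [hammingDist_comp_perm, hd]⟩
  rintro _ ⟨a, ha, rfl⟩ _ ⟨b, hb, rfl⟩ hab
  rw [hammingDist_comp_perm]
  exact hle a ha b hb fun h => hab (by rw [h])

/-- Shortening commutes with equivalence maps. -/
theorem shorten_image {n : ℕ} {A : Type*} (E : Set (Fin (n + 1) → A))
    (P : Equiv.Perm (Fin (n + 1))) (τ : Fin (n + 1) → Equiv.Perm A) (i : Fin (n + 1)) (w : A)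
    (π : Equiv.Perm (Fin n)) (hπ : ∀ j, P (i.succAbove j) = (P i).succAbove (π j)) :
    shorten ((fun c j => τ j (c (P j))) '' E) i (τ i w) =
      (fun c j => τ (i.succAbove j) (c (π j))) '' shorten E (P i) w := by
  ext x
  constructor
  · rintro ⟨_, ⟨c, hc, rfl⟩, hw, rfl⟩
    exact ⟨_, ⟨c, hc, (τ i).injective hw, rfl⟩, by simp only [hπ]⟩
  · rintro ⟨_, ⟨c, hc, hw, rfl⟩, rfl⟩
    exact ⟨_, ⟨c, hc, rfl⟩, by simp only [hw], by simp only [hπ]⟩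

theorem exists_perm_succAbove {n : ℕ} (P : Equiv.Perm (Fin (n + 1))) (i : Fin (n + 1)) :
    ∃ π : Equiv.Perm (Fin n), ∀ j, P (i.succAbove j) = (P i).succAbove (π j) := by
  refine ⟨(finSuccAboveEquiv i).trans ((P.subtypeEquiv fun a => by simp).trans
    (finSuccAboveEquiv (P i)).symm), fun j => ?_⟩
  exact congrArg Subtype.val ((finSuccAboveEquiv (P i)).apply_symm_apply
    ⟨P (i.succAbove j), by simp⟩).symm

theorem exists_perm_extending {n : ℕ} (π : Equiv.Perm (Fin n)) (i : Fin (n + 1)) :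
    ∃ P : Equiv.Perm (Fin (n + 1)), P 0 = i ∧
      ∀ j, P ((0 : Fin (n + 1)).succAbove j) = i.succAbove (π j) :=
  ⟨(finSuccEquiv' 0).trans (π.optionCongr.trans (finSuccEquiv' i).symm), by simp, fun j => by
    simp only [Equiv.trans_apply, finSuccEquiv'_succAbove]; simp⟩

/-- The Singleton bound. -/
theorem ncard_le_of_lt_hammingDist {n d : ℕ} {A : Type*} [Fintype A] [DecidableEq A]
    (D : Set (Fin n → A)) (h : ∀ c ∈ D, ∀ c' ∈ D, c ≠ c' → d < hammingDist c c') :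
    D.ncard ≤ Fintype.card A ^ (n - d) := by
  let f : (Fin n → A) → (Fin (n - d) → A) := fun c j => c (Fin.castLE (n.sub_le d) j)
  have hf : Set.InjOn f D := by
    intro c hc c' hc' hcc'
    by_contra hne
    refine absurd (h c hc c' hc' hne) (not_lt.mpr ?_)
    have hsub : Finset.univ.filter (fun i => c i ≠ c' i) ⊆
        Finset.univ \ Finset.univ.map (Fin.castLEEmb (n.sub_le d)) := by
      intro i hi
      simp only [Finset.mem_sdiff, Finset.mem_univ, Finset.mem_map, true_and]
      rintro ⟨j, rfl⟩
      exact (Finset.mem_filter.mp hi).2 (congrFun hcc' j)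
    refine (Finset.card_le_card hsub).trans ?_
    rw [Finset.card_sdiff_of_subset (Finset.subset_univ _)]
    simp
    omega
  calc D.ncard = (f '' D).ncard := hf.ncard_image.symm
    _ ≤ Nat.card (Fin (n - d) → A) := Set.ncard_le_card _
    _ = _ := by simp

theorem minDistIs_three_of_ncard {n : ℕ} {A : Type*} [Fintype A] [DecidableEq A]
    (hA : 2 ≤ Fintype.card A) (hn : 3 ≤ n) {D : Set (Fin n → A)}
    (hD : D.ncard = Fintype.card A ^ (n - 2))
    (h : ∀ c ∈ D, ∀ c' ∈ D, c ≠ c' → 3 ≤ hammingDist c c') : minDistIs D 3 := by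
  refine ⟨h, ?_⟩
  by_contra! hne
  have := ncard_le_of_lt_hammingDist (d := 3) D fun c hc c' hc' hcc' =>
    lt_of_le_of_ne (h c hc c' hc' hcc') (hne c hc c' hc' hcc').symm
  rw [hD] at this
  exact absurd this (not_le.mpr (Nat.pow_lt_pow_right hA (by omega)))

theorem shorten_le_hammingDist {n d : ℕ} {A : Type*} [DecidableEq A]
    {E : Set (Fin (n + 1) → A)} (h : ∀ c ∈ E, ∀ c' ∈ E, c ≠ c' → d ≤ hammingDist c c')
    (i : Fin (n + 1)) (v : A) :
    ∀ c ∈ shorten E i v, ∀ c' ∈ shorten E i v, c ≠ c' → d ≤ hammingDist c c' := by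
  rintro _ ⟨a, ha, hav, rfl⟩ _ ⟨b, hb, hbv, rfl⟩ hne
  rw [hammingDist_succAbove i (hav.trans hbv.symm)]
  exact h a ha b hb fun hab => hne (by rw [hab])

theorem ncard_shorten {n : ℕ} {A : Type*} (E : Set (Fin (n + 1) → A)) (i : Fin (n + 1))
    (v : A) : (shorten E i v).ncard = {c ∈ E | c i = v}.ncard := by
  have : shorten E i v = (fun c j => c (i.succAbove j)) '' {c ∈ E | c i = v} := by
    ext x
    constructor
    · rintro ⟨c, hc, hv, rfl⟩
      exact ⟨c, ⟨hc, hv⟩, rfl⟩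
    · rintro ⟨c, ⟨hc, hv⟩, rfl⟩
      exact ⟨c, hc, hv, rfl⟩
  rw [this]
  refine Set.InjOn.ncard_image fun c hc c' hc' h => ?_
  ext j
  obtain rfl | ⟨k, rfl⟩ := Fin.eq_self_or_eq_succAbove i j
  · exact hc.2.trans hc'.2.symm
  · exact congrFun h k

/-- Some shortening is at least as large as the average shortening. -/
theorem exists_le_ncard_shorten {n m : ℕ} {A : Type*} [Fintype A] [Nonempty A]
    {E : Set (Fin (n + 1) → A)} (i : Fin (n + 1)) (h : Fintype.card A * m ≤ E.ncard) :
    ∃ v, m ≤ (shorten E i v).ncard := by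
  classical
  obtain ⟨v, -, hv⟩ := Finset.exists_le_card_fiber_of_mul_le_card_of_maps_to
    (s := E.toFinset) (t := Finset.univ) (f := fun c => c i) (n := m) (by simp)
    Finset.univ_nonempty (by simpa [Set.ncard_eq_toFinset_card'] using h)
  refine ⟨v, hv.trans_eq ?_⟩
  rw [ncard_shorten, ← Set.ncard_coe_finset]
  congr 1
  ext c
  simp

/-- Let `Ĉ₁, …, Ĉ_N` be representatives, containing the all-zero word, of the equivalence
classes of `(n, q^(n-2), 3)_q` codes, exactly one from each class, and let `φ` map every
`(n, q^(n-2), 3)_q` code `C` to the index `φ(C)` with `C ≅ Ĉ_{φ(C)}`. Then every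
`(n+1, q^(n-1), 3)_q` code is equivalent to a semi-canonical code `C`, i.e. one with
(1) minimum distance `3`, (2) `s(C,1,0) = Ĉ_k` for some `k`, and (3) `φ(s(C,i,v)) ≥ k`
for all `i, v` for which `s(C,i,v)` has `q^(n-2)` codewords. -/
theorem exists_semicanonical_form (q n N : ℕ) (hq : 2 ≤ q) (hn : 3 ≤ n)
    (Chat : Fin N → Set (Fin n → ZMod q))
    (hChatCode : ∀ k, (Chat k).ncard = q ^ (n - 2) ∧ minDistIs (Chat k) 3 ∧
      (fun _ : Fin n => (0 : ZMod q)) ∈ Chat k)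
    (hChatRep : ∀ D : Set (Fin n → ZMod q),
      D.ncard = q ^ (n - 2) → minDistIs D 3 → ∃! k : Fin N, CodeEquiv D (Chat k))
    (φ : Set (Fin n → ZMod q) → Fin N)
    (hφ : ∀ D : Set (Fin n → ZMod q),
      D.ncard = q ^ (n - 2) → minDistIs D 3 → CodeEquiv D (Chat (φ D)))
    (E : Set (Fin (n + 1) → ZMod q))
    (hEsize : E.ncard = q ^ (n - 1)) (hEmin : minDistIs E 3) :
    ∃ C : Set (Fin (n + 1) → ZMod q),
      CodeEquiv E C ∧
      minDistIs C 3 ∧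
      ∃ k : Fin N,
        shorten C 0 0 = Chat k ∧
        ∀ (i : Fin (n + 1)) (v : ZMod q),
          (shorten C i v).ncard = q ^ (n - 2) → k ≤ φ (shorten C i v) := by
  have : NeZero q := ⟨by omega⟩
  have hcode : ∀ i v, (shorten E i v).ncard = q ^ (n - 2) → minDistIs (shorten E i v) 3 :=
    fun i v h => minDistIs_three_of_ncard (by simpa using hq) hn (by simpa using h)
      (shorten_le_hammingDist hEmin.1 i v)
  let S : Set (Fin (n + 1) × ZMod q) := {p | (shorten E p.1 p.2).ncard = q ^ (n - 2)}
  have hS : S.Nonempty := by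
    obtain ⟨v, hv⟩ := exists_le_ncard_shorten (E := E) (m := q ^ (n - 2)) 0 (by
      rw [hEsize, ZMod.card, ← pow_succ', show n - 2 + 1 = n - 1 by omega])
    refine ⟨(0, v), le_antisymm ?_ hv⟩
    simpa using ncard_le_of_lt_hammingDist (d := 2) _ (shorten_le_hammingDist hEmin.1 0 v)
  obtain ⟨⟨i, v⟩, hiv, hmin⟩ :=
    Set.exists_min_image S (fun p => φ (shorten E p.1 p.2)) (Set.toFinite S) hS
  obtain ⟨π, σ, hπσ⟩ := hφ _ hiv (hcode i v hiv)
  obtain ⟨P, rfl, hP⟩ := exists_perm_extending π i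
  let τ : Fin (n + 1) → Equiv.Perm (ZMod q) := Fin.cons (Equiv.swap v 0) σ
  have hequiv : CodeEquiv E ((fun c j => τ j (c (P j))) '' E) := ⟨P, τ, rfl⟩
  refine ⟨_, hequiv, hequiv.minDistIs hEmin, _, Eq.trans ?_ hπσ.symm, fun j w hjw => ?_⟩
  · have := shorten_image E P τ 0 v π hP
    simpa [τ] using this
  · obtain ⟨ρ, hρ⟩ := exists_perm_succAbove P j
    have heq : CodeEquiv (shorten E (P j) ((τ j).symm w))
        (shorten ((fun c j => τ j (c (P j))) '' E) j w) :=
      ⟨ρ, fun l => τ (j.succAbove l), by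
        simpa using shorten_image E P τ j ((τ j).symm w) ρ hρ⟩
    have hcard := heq.ncard_eq.symm.trans hjw
    have hd := hcode _ _ hcard
    refine (hmin (P j, (τ j).symm w) hcard).trans_eq ?_
    exact (hChatRep _ hcard hd).unique (hφ _ hcard hd)
      (heq.trans (hφ _ hjw (heq.minDistIs hd)))
end
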